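/- Let M/K be a fully ramified biquadratic extension of 2-adic fields with two ramification breaks b₁ < b₂ satisfying b₁ + b₂ > 2e_K, embedded in a quaternion extension N = M(√α_k). Then def_M(α_k) = 4e_K − b₂, and consequently the third ramification break of N/K is b₃ = 4e_K + b₂. -/

import Mathlib

def DiscreteVal (F : Type*) [Field F] (v : F → WithTop ℤ) : Prop :=
  v 0 = ⊤ ∧ (∀ x : F, v x = ⊤ → x = 0) ∧ (∀ x y : F, v (x * y) = v x + v y) ∧
    (∀ x y : F, min (v x) (v y) ≤ v (x + y)) ∧ (∃ π : F, v π = 1)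

def HasQuadDefect {F : Type*} [Field F] (v : F → WithTop ℤ) (κ : F) (d : WithTop ℤ) : Prop :=
  IsGreatest {n : WithTop ℤ | ∃ k : F, v (k ^ 2 * κ - 1) = n} d


set_option linter.unusedSectionVars false

section Val
variable {F : Type*} [Field F] {v : F → WithTop ℤ}

/-- valuation at least `n` -/
def VG (v : F → WithTop ℤ) (n : ℤ) (x : F) : Prop := (n : WithTop ℤ) ≤ v x
/-- valuation exactly `n` -/
def VE (v : F → WithTop ℤ) (n : ℤ) (x : F) : Prop := v x = (n : WithTop ℤ)

theorem VE.g {n m : ℤ} {x : F} (h : VE v n x) (hm : m ≤ n) : VG v m x := by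
  unfold VG; rw [h]; exact_mod_cast hm

theorem VE.eq {n m : ℤ} {x : F} (h : VE v n x) (h' : VE v m x) : n = m := by
  unfold VE at h h'; rw [h] at h'; exact_mod_cast h'

theorem VE.le {n m : ℤ} {x : F} (h : VE v n x) (h' : VG v m x) : m ≤ n := by
  unfold VE at h; unfold VG at h'; rw [h] at h'; exact_mod_cast h'

theorem VE.cast {n m : ℤ} {x : F} (h : VE v n x) (e : n = m) : VE v m x := e ▸ h

theorem VG.mono {n m : ℤ} {x : F} (h : VG v n x) (hm : m ≤ n) : VG v m x :=
  le_trans (by exact_mod_cast hm) h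

theorem VG.dich {n : ℤ} {x : F} (h : VG v n x) : VE v n x ∨ VG v (n+1) x := by
  unfold VG VE at *
  cases hx : v x with
  | top => right; exact le_top
  | coe a =>
    rw [hx] at h
    have : n ≤ a := by exact_mod_cast h
    rcases this.lt_or_eq with h | h
    · right; exact_mod_cast h
    · left; rw [h]

variable (hv : DiscreteVal F v)
include hv

theorem VE.ne {n : ℤ} {x : F} (h : VE v n x) : x ≠ 0 := by
  rintro rfl
  unfold VE at h; rw [hv.1] at h; exact WithTop.top_ne_coe h

theorem ve_ex {x : F} (h : x ≠ 0) : ∃ n, VE v n x := by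
  unfold VE
  cases hx : v x with
  | top => exact absurd (hv.2.1 x hx) h
  | coe a => exact ⟨a, rfl⟩

theorem vg_zero (n : ℤ) : VG v n (0:F) := by unfold VG; rw [hv.1]; exact le_top

theorem VE.mul {n m : ℤ} {x y : F} (h : VE v n x) (h' : VE v m y) : VE v (n+m) (x*y) := by
  unfold VE at *; rw [hv.2.2.1, h, h']; rfl

theorem VG.mul {n m : ℤ} {x y : F} (h : VG v n x) (h' : VG v m y) : VG v (n+m) (x*y) := by
  unfold VG at *; rw [hv.2.2.1]; push_cast; exact add_le_add h h'

theorem ve_one : VE v 0 (1:F) := by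
  obtain ⟨n, hn⟩ := ve_ex hv (one_ne_zero : (1:F) ≠ 0)
  have := hn.mul hv hn
  rw [one_mul] at this
  have := this.eq hn
  exact hn.cast (by omega)

theorem ve_neg_one : VE v 0 (-1:F) := by
  obtain ⟨n, hn⟩ := ve_ex hv (neg_ne_zero.mpr one_ne_zero : (-1:F) ≠ 0)
  have := hn.mul hv hn
  rw [neg_mul_neg, one_mul] at this
  have := this.eq (ve_one hv)
  exact hn.cast (by omega)

theorem VE.neg {n : ℤ} {x : F} (h : VE v n x) : VE v n (-x) := by
  have := (ve_neg_one hv).mul hv h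
  rw [neg_one_mul] at this
  exact this.cast (by omega)

theorem VG.neg {n : ℤ} {x : F} (h : VG v n x) : VG v n (-x) := by
  have := ((ve_neg_one hv).g le_rfl).mul hv h
  rw [neg_one_mul] at this
  exact this.mono (by omega)

theorem VG.add {n : ℤ} {x y : F} (h : VG v n x) (h' : VG v n y) : VG v n (x+y) :=
  le_trans (le_min h h') (hv.2.2.2.1 x y)

theorem VG.sub {n : ℤ} {x y : F} (h : VG v n x) (h' : VG v n y) : VG v n (x-y) := by
  rw [sub_eq_add_neg]; exact h.add hv (h'.neg hv)

theorem VE.add_g {n m : ℤ} {x y : F} (h : VE v n x) (h' : VG v m y) (hm : n < m) :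
    VE v n (x+y) := by
  have h1 : VG v n (x+y) := (h.g le_rfl).add hv (h'.mono hm.le)
  rcases h1.dich with h2 | h2
  · exact h2
  · have h3 := h2.sub hv (h'.mono hm)
    rw [add_sub_cancel_right] at h3
    have := h.le h3
    omega

theorem VE.sub_g {n m : ℤ} {x y : F} (h : VE v n x) (h' : VG v m y) (hm : n < m) :
    VE v n (x-y) := by
  rw [sub_eq_add_neg]; exact h.add_g hv (h'.neg hv) hm

theorem VE.inv {n : ℤ} {x : F} (h : VE v n x) : VE v (-n) x⁻¹ := by
  have hx := h.ne hv
  obtain ⟨m, hm⟩ := ve_ex hv (inv_ne_zero hx)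
  have := h.mul hv hm
  rw [mul_inv_cancel₀ hx] at this
  have := this.eq (ve_one hv)
  exact hm.cast (by omega)

theorem VE.pow {n : ℤ} {x : F} (h : VE v n x) (k : ℕ) : VE v (k*n) (x^k) := by
  induction k with
  | zero => simpa using ve_one hv
  | succ k ih => rw [pow_succ]; exact (ih.mul hv h).cast (by push_cast; ring)

theorem VE.zpow {n : ℤ} {x : F} (h : VE v n x) (k : ℤ) : VE v (k*n) (x^k) := by
  cases k with
  | ofNat k => simpa using h.pow hv k
  | negSucc k =>
    rw [zpow_negSucc]
    exact ((h.pow hv (k+1)).inv hv).cast (by rw [Int.negSucc_eq]; push_cast; ring)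

theorem VE.sq {n : ℤ} {x : F} (h : VE v n x) : VE v (2*n) (x^2) := h.pow hv 2

theorem VG.sq {n : ℤ} {x : F} (h : VG v n x) : VG v (2*n) (x^2) := by
  rw [_root_.sq, two_mul]; exact h.mul hv h

theorem VG.pow {x : F} (h : VG v 0 x) (k : ℕ) : VG v 0 (x^k) := by
  induction k with
  | zero => simpa using (ve_one hv).g le_rfl
  | succ k ih => rw [pow_succ]; exact (ih.mul hv h).mono (by omega)

theorem VG.mul_e {n m : ℤ} {x y : F} (h : VG v n x) (h' : VE v m y) : VG v (n+m) (x*y) :=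
  h.mul hv (h'.g le_rfl)

/-- cancel a factor -/
theorem VE.of_mul {n m : ℤ} {x y : F} (h : VE v n (x*y)) (h' : VE v m y) : VE v (n-m) x := by
  have := h.mul hv (h'.inv hv)
  rw [mul_assoc, mul_inv_cancel₀ (h'.ne hv), mul_one] at this
  exact this

theorem VG.of_mul {n m : ℤ} {x y : F} (h : VG v n (x*y)) (h' : VE v m y) : VG v (n-m) x := by
  have := h.mul_e hv (h'.inv hv)
  rw [mul_assoc, mul_inv_cancel₀ (h'.ne hv), mul_one] at this
  exact this

theorem VE.of_sq {n : ℤ} {x : F} (h : VE v (2*n) (x^2)) : VE v n x := by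
  have hx : x ≠ 0 := by
    rintro rfl
    exact h.ne hv (by simp)
  obtain ⟨m, hm⟩ := ve_ex hv hx
  have := (hm.sq hv).eq h
  exact hm.cast (by omega)

theorem vg_two : VG v 0 (2:F) := by
  rw [← one_add_one_eq_two]; exact ((ve_one hv).g le_rfl).add hv ((ve_one hv).g le_rfl)

theorem unit_of_sub_one {n : ℤ} (hn : 0 < n) {x : F} (h : VG v n (x-1)) : VE v 0 x := by
  have := (ve_one hv).add_g hv h hn
  rwa [add_sub_cancel] at this

/-- product of elements close to one -/
theorem one_mul_g {n : ℤ} (hn : 0 < n) {x y : F} (hx : VG v n (x-1)) (hy : VG v n (y-1)) :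
    VG v n (x*y-1) := by
  have e : x*y-1 = (x-1)*y + (y-1) := by ring
  rw [e]
  exact ((hx.mul_e hv (unit_of_sub_one hv hn hy)).mono (by omega)).add hv hy

theorem one_mul_e {n : ℤ} (hn : 0 < n) {x y : F} (hx : VG v (n+1) (x-1)) (hy : VE v n (y-1)) :
    VE v n (x*y-1) := by
  have e : x*y-1 = (y-1) + (x-1)*y := by ring
  rw [e]
  exact hy.add_g hv (m := n+1) ((hx.mul_e hv (unit_of_sub_one hv hn (hy.g le_rfl))).mono (by omega)) (by omega)

/-- `q^2+2q` of small valuation -/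
theorem sq_e {E a : ℤ} (h2 : VE v E (2:F)) {q : F} (h : VE v (2*a) (q*(q+2))) (ha : a < E) :
    VE v a q := by
  have hq : q ≠ 0 := by
    rintro rfl
    exact h.ne hv (by simp)
  obtain ⟨n, hn⟩ := ve_ex hv hq
  rcases lt_or_ge n E with h1 | h1
  · have := (hn.mul hv (hn.add_g hv (h2.g le_rfl) h1)).eq h
    exact hn.cast (by omega)
  · have := h.le ((hn.g h1).mul hv ((hn.g h1).add hv (h2.g le_rfl)))
    omega

theorem sq_g {E a : ℤ} (h2 : VE v E (2:F)) {q : F} (h : VG v (2*a) (q*(q+2))) (ha : a ≤ E) :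
    VG v a q := by
  rcases eq_or_ne q 0 with rfl | hq
  · exact vg_zero hv _
  obtain ⟨n, hn⟩ := ve_ex hv hq
  rcases lt_or_ge n E with h1 | h1
  · have := (hn.mul hv (hn.add_g hv (h2.g le_rfl) h1)).le h
    exact hn.g (by omega)
  · exact hn.g (by omega)

/-- Upper bound on the quadratic defect. -/
theorem defect_of_odd {E D : ℤ} (h2 : VE v E (2:F)) (hD0 : 0 < D) (hD : D < 2*E) (hodd : D % 2 = 1)
    {α z : F} (h : VE v D (z^2*α-1)) : HasQuadDefect v α (D : WithTop ℤ) := by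
  refine ⟨⟨z, h⟩, ?_⟩
  rintro n ⟨k, rfl⟩
  by_contra hlt
  have hg : VG v (D+1) (k^2*α-1) := by
    unfold VG
    rw [not_le] at hlt
    cases hx : v (k^2*α-1) with
    | top => exact le_top
    | coe a => rw [hx] at hlt; have : D < a := by exact_mod_cast hlt
               exact_mod_cast this
  have hk := unit_of_sub_one hv (by omega) hg
  have hz := unit_of_sub_one hv hD0 (h.g le_rfl)
  have hz0 : z ≠ 0 := by
    rintro rfl
    exact hz.ne hv (by simp)
  have ha0 : α ≠ 0 := by
    rintro rfl
    exact hz.ne hv (by simp)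
  -- (k/z)^2
  have e : (k/z - 1) * ((k/z-1)+2) = ((k^2*α-1) - (z^2*α-1)) * (z^2*α)⁻¹ := by
    field_simp; ring
  have h3 : VE v D ((k^2*α-1) - (z^2*α-1)) := by
    have := (h.neg hv).add_g hv hg (by omega)
    convert this using 1; ring
  have h4 := h3.mul hv (hz.inv hv)
  rw [← e] at h4
  have hq : k/z-1 ≠ 0 := by
    intro h0
    rw [h0] at h4
    exact h4.ne hv (by simp)
  obtain ⟨n, hn⟩ := ve_ex hv hq
  rcases lt_or_ge n E with h1 | h1
  · have := (hn.mul hv (hn.add_g hv (h2.g le_rfl) h1)).eq h4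
    omega
  · have := h4.le ((hn.g h1).mul hv ((hn.g h1).add hv (h2.g le_rfl)))
    omega

end Val


section Perf
variable {K : Type*} [Field K] {w : K → WithTop ℤ} (hw : DiscreteVal K w)
include hw

theorem sum_sq_cong (h2 : VG w 1 (2:K)) (f : ℕ → K) (hf : ∀ i, VG w 0 (f i)) (n : ℕ) :
    VG w 0 (∑ i ∈ Finset.range n, f i) ∧
    VG w 1 ((∑ i ∈ Finset.range n, f i)^2 - ∑ i ∈ Finset.range n, (f i)^2) := by
  induction n with
  | zero => simp [vg_zero hw]
  | succ n ih =>
    rw [Finset.sum_range_succ, Finset.sum_range_succ]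
    refine ⟨ih.1.add hw (hf n), ?_⟩
    have e : ((∑ i ∈ Finset.range n, f i) + f n)^2 - (∑ i ∈ Finset.range n, (f i)^2 + (f n)^2)
      = ((∑ i ∈ Finset.range n, f i)^2 - ∑ i ∈ Finset.range n, (f i)^2)
        + 2 * (∑ i ∈ Finset.range n, f i) * f n := by ring
    rw [e]
    exact ih.2.add hw (((h2.mul hw ih.1).mul hw (hf n)).mono (by omega))

theorem frob_rel (h2 : VG w 1 (2:K)) {a : K} (ha : VG w 0 a) (n : ℕ) :
    ∀ d : ℕ → K, (∀ i, d i = 0 ∨ d i = 1) → (∃ j < n, d j = 1) →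
      VG w 1 (∑ i ∈ Finset.range n, d i * a^(2^i)) → ∃ c, VG w 1 (a - c^2) := by
  induction n with
  | zero => intro d _ ⟨j, hj, _⟩; omega
  | succ n ih =>
    intro d hd ⟨j, hj, hdj⟩ hs
    have hint : ∀ i, VG w 0 (d (i+1) * a^(2^i)) := by
      intro i
      rcases hd (i+1) with h | h <;> rw [h]
      · rw [zero_mul]; exact vg_zero hw _
      · rw [one_mul]; exact ha.pow hw _
    obtain ⟨h0, h1⟩ := sum_sq_cong hw h2 _ hint n
    have e : ∑ i ∈ Finset.range n, (d (i+1) * a^(2^i))^2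
        = ∑ i ∈ Finset.range n, d (i+1) * a^(2^(i+1)) := by
      apply Finset.sum_congr rfl
      intro i _
      rw [mul_pow, ← pow_mul, ← pow_succ]
      rcases hd (i+1) with h | h <;> rw [h] <;> ring
    rw [e] at h1
    rw [Finset.sum_range_succ'] at hs
    set S := ∑ i ∈ Finset.range n, d (i+1) * a^(2^i)
    rcases hd 0 with h | h
    · have h3 : VG w 1 (S^2) := by
        have := h1.add hw hs
        rw [h] at this
        simpa using this
      have h4 : VG w 1 S := by
        rcases h0.dich with h5 | h5
        · have := (h5.sq hw).le h3
          omega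
        · exact h5
      refine ih (fun i => d (i+1)) (fun i => hd _) ?_ h4
      obtain _ | j := j
      · rw [h] at hdj; exact absurd hdj zero_ne_one
      · exact ⟨j, by omega, hdj⟩
    · refine ⟨S, ?_⟩
      have := (h1.add hw hs).sub hw ((h2.mul hw (h0.sq hw)).mono (show (1:ℤ) ≤ _ by omega))
      convert this using 1
      rw [h]; simp; ring

theorem cube_dvd (ι : ℤ_[2] →+* K) (k : ℕ) : ∀ (u : ℤ_[2]) (n : ℤ), ‖u - 1‖ < 1 →
    VE w n (ι u) → (3:ℤ)^k ∣ n := by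
  induction k with
  | zero => intros; simp
  | succ k ih =>
    intro u n hu hn
    have h3 : ‖(3:ℤ_[2])‖ = 1 := by
      have : ‖((3:ℤ):ℤ_[2])‖ = 1 := by
        apply le_antisymm (PadicInt.norm_le_one _)
        by_contra h
        rw [not_le, PadicInt.norm_intCast_lt_one_iff] at h
        norm_num at h
      simpa using this
    have h3' : ‖(2+1:ℤ_[2])‖ = 1 := by rw [← h3]; norm_num
    obtain ⟨z, hz, hz1, -⟩ := hensels_lemma (p := 2) (R := ℤ_[2])
      (F := (Polynomial.X^3 - Polynomial.C u : Polynomial ℤ_[2])) (a := (1:ℤ_[2])) (by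
        simp [h3']
        rw [← norm_neg]; simpa using hu)
    simp [h3'] at hz hz1
    have hzu : z^3 = u := by linear_combination hz
    have hz0 : ι z ≠ 0 := by
      intro h0
      apply hn.ne hw
      rw [← hzu, map_pow, h0]; simp
    obtain ⟨m, hm⟩ := ve_ex hw hz0
    have h1 := ih z m hz1 hm
    have h2 := hm.pow hw 3
    have : VE w n (ι z^3) := by
      rwa [← hzu, map_pow] at hn
    have h4 := h2.eq this
    rw [← h4, pow_succ, mul_comm]
    exact mul_dvd_mul (by norm_num) h1

theorem unit_val (ι : ℤ_[2] →+* K) (u : ℤ_[2]) (hu : ‖u - 1‖ < 1) :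
    VE w 0 (ι u) := by
  have : ι u ≠ 0 := by
    have h1 : IsUnit u := by
      rw [PadicInt.isUnit_iff]
      have := PadicInt.norm_add_eq_max_of_ne (p := 2) (q := u - 1) (r := 1) (by simpa using hu.ne)
      rw [sub_add_cancel] at this
      rw [this]; simpa using hu.le
    exact (h1.map ι).ne_zero
  obtain ⟨n, hn⟩ := ve_ex hw this
  have h := fun k => cube_dvd hw ι k u n hu hn
  have h0 : n = 0 := by
    by_contra hne
    have h1 := Int.le_of_dvd (Int.natAbs_pos.mpr hne |> Int.natCast_pos.mpr) ((Int.dvd_natAbs).mpr (h n.natAbs))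
    have h2 : n.natAbs < 3^n.natAbs := Nat.lt_pow_self (by norm_num)
    have : ((n.natAbs:ℕ):ℤ) < 3^n.natAbs := by exact_mod_cast h2
    omega
  exact hn.cast h0

theorem int_res (ι : ℤ_[2] →+* K) (h2 : VG w 1 (2:K)) (x : ℤ_[2]) :
    VG w 1 (ι x) ∨ VG w 1 (ι x - 1) := by
  have hint : ∀ y : ℤ_[2], ‖y‖ < 1 → VG w 0 (ι y) := by
    intro y hy
    have := unit_val hw ι (1+y) (by simpa using hy)
    have := (this.g le_rfl).sub hw ((ve_one hw).g le_rfl)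
    simpa using this
  have hint' : ∀ y : ℤ_[2], VG w 0 (ι y) := by
    intro y
    obtain ⟨n, hn, hm⟩ := PadicInt.exists_mem_range (p := 2) y
    rw [IsLocalRing.mem_maximalIdeal, PadicInt.mem_nonunits] at hm
    interval_cases n
    · exact hint y (by simpa using hm)
    · exact (unit_val hw ι y (by simpa using hm)).g le_rfl
  have hdiv : ∀ y : ℤ_[2], ‖y‖ < 1 → VG w 1 (ι y) := by
    intro y hy
    rw [PadicInt.norm_lt_one_iff_dvd] at hy
    obtain ⟨z, rfl⟩ := hy
    rw [map_mul]
    have e2 : ι ((2:ℕ):ℤ_[2]) = 2 := by rw [map_natCast]; norm_num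
    rw [e2]
    exact (h2.mul hw (hint' z)).mono (by omega)
  obtain ⟨n, hn, hm⟩ := PadicInt.exists_mem_range (p := 2) x
  rw [IsLocalRing.mem_maximalIdeal, PadicInt.mem_nonunits] at hm
  interval_cases n
  · left; exact hdiv x (by simpa using hm)
  · right
    have := hdiv (x-1) (by simpa using hm)
    simpa using this

theorem perf [Algebra ℚ_[2] K] [FiniteDimensional ℚ_[2] K] (h2 : VG w 1 (2:K)) {a : K}
    (ha : VE w 0 a) : ∃ c, VE w 0 c ∧ VG w 1 (a - c^2) := by
  suffices h : ∃ c, VG w 1 (a - c^2) by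
    obtain ⟨c, hc⟩ := h
    refine ⟨c, ?_, hc⟩
    have := ha.sub_g hw hc (by omega)
    rw [sub_sub_cancel] at this
    exact VE.of_sq hw (this.cast (by ring))
  set n := Module.finrank ℚ_[2] K
  have hdep : ¬ LinearIndependent ℚ_[2] (fun i : Fin (n+1) => a^(2^(i:ℕ))) := by
    intro h
    have := h.fintype_card_le_finrank
    simp [n] at this
  rw [Fintype.not_linearIndependent_iff] at hdep
  obtain ⟨g, hg, i0, hi0⟩ := hdep
  obtain ⟨j, -, hj⟩ := Finset.exists_max_image Finset.univ (fun i => ‖g i‖) ⟨i0, Finset.mem_univ _⟩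
  have hj0 : g j ≠ 0 := by
    intro h
    have := hj i0 (Finset.mem_univ _)
    simp [h] at this
    exact hi0 this
  have hle : ∀ i, ‖g i / g j‖ ≤ 1 := by
    intro i
    rw [norm_div]
    exact div_le_one_of_le₀ (hj i (Finset.mem_univ _)) (norm_nonneg _)
  let q : Fin (n+1) → ℤ_[2] := fun i => ⟨g i / g j, hle i⟩
  let ι : ℤ_[2] →+* K := (algebraMap ℚ_[2] K).comp PadicInt.Coe.ringHom
  have hιq : ∀ i, ι (q i) = algebraMap ℚ_[2] K (g i / g j) := fun i => rfl
  have hq : ∑ i, ι (q i) * a^(2^(i:ℕ)) = 0 := by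
    have : ∑ i, ι (q i) * a^(2^(i:ℕ))
        = algebraMap ℚ_[2] K (g j)⁻¹ * ∑ i, g i • a^(2^(i:ℕ)) := by
      rw [Finset.mul_sum]
      apply Finset.sum_congr rfl
      intro i _
      rw [hιq, Algebra.smul_def]
      rw [div_eq_mul_inv, map_mul]; ring
    rw [this, hg, mul_zero]
  have hd : ∀ i, ∃ d : K, (d = 0 ∨ d = 1) ∧ VG w 1 (ι (q i) - d) := by
    intro i
    rcases int_res hw ι h2 (q i) with h | h
    · exact ⟨0, Or.inl rfl, by simpa using h⟩
    · exact ⟨1, Or.inr rfl, h⟩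
  choose d hd1 hd2 using hd
  have hqj : ι (q j) = 1 := by
    rw [hιq, div_self hj0, map_one]
  have hdj : d j = 1 := by
    rcases hd1 j with h | h
    · have := hd2 j
      rw [h, hqj, sub_zero] at this
      have := (ve_one hw).le this
      omega
    · exact h
  refine frob_rel hw h2 (ha.g le_rfl) (n+1) (fun i => if h : i < n+1 then d ⟨i,h⟩ else 0) ?_
    ⟨j, j.2, by rw [dif_pos j.2]; exact hdj⟩ ?_
  · intro i
    by_cases h : i < n+1
    · simp only [h, dif_pos]; exact hd1 _
    · simp [h]
  · rw [Finset.sum_range]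
    have : ∑ i : Fin (n+1), (if h : (i:ℕ) < n+1 then d ⟨i,h⟩ else 0) * a^(2^(i:ℕ))
        = ∑ i : Fin (n+1), -((ι (q i) - d i) * a^(2^(i:ℕ))) := by
      rw [← sub_eq_zero, ← Finset.sum_sub_distrib]
      refine Eq.trans ?_ hq
      apply Finset.sum_congr rfl
      intro i _
      rw [dif_pos i.2]; ring
    rw [this]
    apply Finset.sum_induction _ (fun x => VG w 1 x)
    · intro x y hx hy; exact hx.add hw hy
    · exact vg_zero hw _
    · intro i _
      exact (((hd2 i).mul hw ((ha.g le_rfl).pow hw _)).mono (by omega)).neg hw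

end Perf


section Pair
variable {F : Type*} [Field F] {v : F → WithTop ℤ} (hv : DiscreteVal F v)
include hv

theorem pair_g {x y : F} (hd : ∀ m, VE v m x → ¬ VE v m y) {n : ℤ} (h : VG v n (x+y)) :
    VG v n x ∧ VG v n y := by
  rcases eq_or_ne x 0 with rfl | hx
  · exact ⟨vg_zero hv _, by simpa using h⟩
  rcases eq_or_ne y 0 with rfl | hy
  · exact ⟨by simpa using h, vg_zero hv _⟩
  obtain ⟨a, ha⟩ := ve_ex hv hx
  obtain ⟨b, hb⟩ := ve_ex hv hy
  have hab : a ≠ b := by rintro rfl; exact hd _ ha hb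
  rcases lt_or_gt_of_ne hab with h1 | h1
  · have := (ha.add_g hv (hb.g le_rfl) h1).le h
    exact ⟨ha.g this, hb.g (by omega)⟩
  · have h2 := (hb.add_g hv (ha.g le_rfl) h1)
    rw [add_comm] at h2
    have := h2.le h
    exact ⟨ha.g (by omega), hb.g this⟩

theorem pair_e {x y : F} (hd : ∀ m, VE v m x → ¬ VE v m y) {n : ℤ} (h : VE v n (x+y)) :
    VE v n x ∨ VE v n y := by
  obtain ⟨h1, h2⟩ := pair_g hv hd (h.g le_rfl)
  rcases h1.dich with h1 | h1
  · exact Or.inl h1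
  rcases h2.dich with h2 | h2
  · exact Or.inr h2
  have := h.le (h1.add hv h2)
  omega

theorem zero_of_vg {x : F} (h : ∀ n, VG v n x) : x = 0 := by
  by_contra hx
  obtain ⟨n, hn⟩ := ve_ex hv hx
  have := hn.le (h (n+1))
  omega
end Pair

section Tot
variable {K M : Type*} [Field K] [Field M] [Algebra K M] {v : M → WithTop ℤ}
  (hv : DiscreteVal M v) (hK : ∀ (a : K) (m : ℤ), VE v m (algebraMap K M a) → m % 4 = 0)
  {π : M} (hπ : VE v 1 π)
include hv hK

theorem k_round {a : K} {n : ℤ} (k : ℤ) (h : VG v n (algebraMap K M a)) (hk : k % 4 = 0)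
    (hn : k < n + 4) : VG v k (algebraMap K M a) := by
  rcases eq_or_ne (algebraMap K M a) 0 with h0 | h0
  · rw [h0]; exact vg_zero hv _
  obtain ⟨m, hm⟩ := ve_ex hv h0
  have := hm.le h
  have := hK a m hm
  exact hm.g (by omega)

theorem kl_dist {ϖ : M} (hϖ : VE v 2 ϖ) (a b : K) (m : ℤ) (h : VE v m (algebraMap K M a)) :
    ¬ VE v m (algebraMap K M b * ϖ) := by
  intro h'
  have := hK a m h
  have := hK b _ (h'.of_mul hv hϖ)
  omega

theorem l_even {ϖ : M} (hϖ : VE v 2 ϖ) (a b : K) (m : ℤ)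
    (h : VE v m (algebraMap K M a + algebraMap K M b * ϖ)) : m % 2 = 0 := by
  rcases pair_e hv (kl_dist hv hK hϖ a b) h with h | h
  · have := hK a m h
    omega
  · have := hK b _ (h.of_mul hv hϖ)
    omega

include hπ

theorem lm_dist {ϖ : M} (hϖ : VE v 2 ϖ) (a b c d : K) (m : ℤ)
    (h : VE v m (algebraMap K M a + algebraMap K M b * ϖ)) :
    ¬ VE v m ((algebraMap K M c + algebraMap K M d * ϖ) * π) := by
  intro h'
  have := l_even hv hK hϖ a b m h
  have := l_even hv hK hϖ c d _ (h'.of_mul hv hπ)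
  omega

theorem quad_g {ϖ : M} (hϖ : VE v 2 ϖ) {a b c d : K} {n : ℤ}
    (h : VG v n ((algebraMap K M a + algebraMap K M b * ϖ) +
      (algebraMap K M c + algebraMap K M d * ϖ) * π)) :
    VG v n (algebraMap K M a) ∧ VG v (n-2) (algebraMap K M b) ∧ VG v (n-1) (algebraMap K M c)
      ∧ VG v (n-3) (algebraMap K M d) := by
  obtain ⟨h1, h2⟩ := pair_g hv (lm_dist hv hK hπ hϖ a b c d) h
  obtain ⟨h3, h4⟩ := pair_g hv (kl_dist hv hK hϖ a b) h1
  obtain ⟨h5, h6⟩ := pair_g hv (kl_dist hv hK hϖ c d) (h2.of_mul hv hπ)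
  exact ⟨h3, h4.of_mul hv hϖ, h5, (h6.of_mul hv hϖ).mono (by omega)⟩

theorem span4 [FiniteDimensional K M] (hfin : Module.finrank K M ≤ 4) {ϖ : M} (hϖ : VE v 2 ϖ)
    (z : M) : ∃ a b c d : K, z = (algebraMap K M a + algebraMap K M b * ϖ) +
      (algebraMap K M c + algebraMap K M d * ϖ) * π := by
  have hli : LinearIndependent K ![(1:M), ϖ, π, ϖ*π] := by
    rw [Fintype.linearIndependent_iff]
    intro g hg
    simp [Fin.sum_univ_four, Algebra.smul_def] at hg
    have h0 : ∀ n, VG v n ((algebraMap K M (g 0) + algebraMap K M (g 1) * ϖ) +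
      (algebraMap K M (g 2) + algebraMap K M (g 3) * ϖ) * π) := by
      intro n
      have e : ((algebraMap K M (g 0) + algebraMap K M (g 1) * ϖ) +
        (algebraMap K M (g 2) + algebraMap K M (g 3) * ϖ) * π) = 0 := by
        rw [← hg]; ring
      rw [e]; exact vg_zero hv _
    have h1 : ∀ i, algebraMap K M (g i) = 0 := by
      intro i
      apply zero_of_vg hv
      intro n
      obtain ⟨h1, h2, h3, h4⟩ := quad_g hv hK hπ hϖ (h0 (n+4))
      fin_cases i
      · exact h1.mono (by omega)
      · exact h2.mono (by omega)
      · exact h3.mono (by omega)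
      · exact h4.mono (by omega)
    intro i
    have := h1 i
    rwa [map_eq_zero] at this
  have hcard : Fintype.card (Fin 4) = Module.finrank K M := by
    have := hli.fintype_card_le_finrank
    simp at this ⊢
    omega
  have hsp := hli.span_eq_top_of_card_eq_finrank' hcard
  have hz : z ∈ Submodule.span K (Set.range ![(1:M), ϖ, π, ϖ*π]) := by rw [hsp]; trivial
  rw [Submodule.mem_span_range_iff_exists_fun] at hz
  obtain ⟨c, hc⟩ := hz
  refine ⟨c 0, c 1, c 2, c 3, ?_⟩
  rw [← hc]
  simp [Fin.sum_univ_four, Algebra.smul_def]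
  ring

theorem aut_pi [FiniteDimensional K M] (hfin : Module.finrank K M ≤ 4) (σ : M ≃ₐ[K] M) :
    VE v 1 (σ π) := by
  obtain ⟨a, b, c, d, h⟩ := span4 hv hK hπ hfin (hπ.sq hv) (π^4)
  have h4 : VE v 4 (π^4) := hπ.pow hv 4
  have hg := h4.g le_rfl
  rw [h] at hg
  obtain ⟨h0, h1, h2, h3⟩ := quad_g hv hK hπ (hπ.sq hv) hg
  replace h1 := k_round hv hK 4 h1 (by omega) (by omega)
  replace h2 := k_round hv hK 4 h2 (by omega) (by omega)
  replace h3 := k_round hv hK 4 h3 (by omega) (by omega)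
  have ha : VE v 4 (algebraMap K M a) := by
    have := h4.sub_g hv (m := 5) (y := algebraMap K M b * π^2 +
      (algebraMap K M c + algebraMap K M d * π^2)*π) ?_ (by omega)
    · convert this using 1
      linear_combination -h
    · refine ((h1.mul_e hv (hπ.sq hv)).mono (by omega)).add hv ?_
      refine (VG.mul_e hv (n := 4) ?_ hπ).mono (by omega)
      exact h2.add hv ((h3.mul_e hv (hπ.sq hv)).mono (by omega))
  have hρ : σ π ≠ 0 := by
    rw [Ne, map_eq_zero_iff σ σ.injective]; exact hπ.ne hv
  obtain ⟨n, hn⟩ := ve_ex hv hρ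
  have hs := congrArg σ h
  simp only [map_add, map_mul, map_pow, AlgEquiv.commutes] at hs
  have e4 : VE v (4*n) ((σ π)^4) := hn.pow hv 4
  have t1 := h1.mul_e hv (hn.sq hv)
  have t2 := h2.mul_e hv hn
  have t3 := h3.mul_e hv (hn.pow hv 3)
  have hs' : (σ π)^4 = algebraMap K M a + (algebraMap K M b * (σ π)^2 +
      algebraMap K M c * σ π + algebraMap K M d * (σ π)^3) := by rw [hs]; ring
  push_cast at t3
  rcases le_or_gt n 0 with h5 | h5
  · have : VG v (4*n+1) ((σ π)^4) := by
      rw [hs']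
      refine (ha.g (by omega)).add hv (VG.add hv (VG.add hv ?_ ?_) ?_)
      · exact t1.mono (by omega)
      · exact t2.mono (by omega)
      · exact t3.mono (by omega)
    have := e4.le this
    omega
  · have : VE v 4 ((σ π)^4) := by
      rw [hs']
      refine ha.add_g hv (m := 5) (VG.add hv (VG.add hv ?_ ?_) ?_) (by omega)
      · exact t1.mono (by omega)
      · exact t2.mono (by omega)
      · exact t3.mono (by omega)
    have := e4.eq this
    exact hn.cast (by omega)

theorem aut_g [FiniteDimensional K M] (hfin : Module.finrank K M ≤ 4) (σ : M ≃ₐ[K] M) {z : M}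
    {n : ℤ} (h : VG v n z) : VG v n (σ z) := by
  have hσ := aut_pi hv hK hπ hfin σ
  obtain ⟨a, b, c, d, rfl⟩ := span4 hv hK hπ hfin (hπ.sq hv) z
  obtain ⟨h0, h1, h2, h3⟩ := quad_g hv hK hπ (hπ.sq hv) h
  simp only [map_add, map_mul, map_pow, AlgEquiv.commutes]
  refine (h0.add hv ((h1.mul_e hv (hσ.sq hv)).mono (by omega))).add hv ?_
  refine (VG.mul_e hv (n := n-1) ?_ hσ).mono (by omega)
  exact h2.add hv ((h3.mul_e hv (hσ.sq hv)).mono (by omega))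

theorem aut_e [FiniteDimensional K M] (hfin : Module.finrank K M ≤ 4) (σ : M ≃ₐ[K] M) {z : M}
    {n : ℤ} (h : VE v n z) : VE v n (σ z) := by
  rcases (aut_g hv hK hπ hfin σ (h.g le_rfl)).dich with h1 | h1
  · exact h1
  · have h2 := aut_g hv hK hπ hfin σ.symm h1
    rw [AlgEquiv.symm_apply_apply] at h2
    have := h.le h2
    omega

theorem res_m [FiniteDimensional K M] (hfin : Module.finrank K M ≤ 4) {z : M}
    (h : VE v 0 z) : ∃ a : K, VE v 0 (algebraMap K M a) ∧ VG v 1 (z - algebraMap K M a) := by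
  obtain ⟨a, b, c, d, e⟩ := span4 hv hK hπ hfin (hπ.sq hv) z
  have h' := h.g le_rfl
  rw [e] at h'
  obtain ⟨h0, h1, h2, h3⟩ := quad_g hv hK hπ (hπ.sq hv) h'
  replace h1 := k_round hv hK 0 h1 (by omega) (by omega)
  replace h2 := k_round hv hK 0 h2 (by omega) (by omega)
  replace h3 := k_round hv hK 0 h3 (by omega) (by omega)
  have key : VG v 1 (z - algebraMap K M a) := by
    have : z - algebraMap K M a = algebraMap K M b * π^2 +
      (algebraMap K M c + algebraMap K M d * π^2)*π := by rw [e]; ring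
    rw [this]
    refine ((h1.mul_e hv (hπ.sq hv)).mono (by omega)).add hv ?_
    refine (VG.mul_e hv (n := 0) ?_ hπ).mono (by omega)
    exact h2.add hv ((h3.mul_e hv (hπ.sq hv)).mono (by omega))
  refine ⟨a, ?_, key⟩
  have := h.sub_g hv key (by omega)
  rwa [sub_sub_cancel] at this

end Tot


/-- totally ramified degree four extension with involutions -/
structure TCtx (K : Type*) {M : Type*} [Field K] [Field M] [Algebra K M] (v : M → WithTop ℤ)
    (π : M) (e : ℤ) : Prop where
  hv : DiscreteVal M v
  hK : ∀ (a : K) (m : ℤ), VE v m (algebraMap K M a) → m % 4 = 0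
  hπ : VE v 1 π
  span : ∀ ϖ : M, VE v 2 ϖ → ∀ z : M, ∃ a b c d : K,
    z = (algebraMap K M a + algebraMap K M b * ϖ) + (algebraMap K M c + algebraMap K M d * ϖ) * π
  aut : ∀ (σ : M ≃ₐ[K] M) (z : M) (n : ℤ), VE v n z → VE v n (σ z)
  two : VE v (4*e) (2:M)

section Brk
variable {K M : Type*} [Field K] [Field M] [Algebra K M] {v : M → WithTop ℤ} {π : M} {e : ℤ}
  (C : TCtx K v π e)
include C

theorem TCtx.autg (σ : M ≃ₐ[K] M) {z : M} {n : ℤ} (h : VG v n z) : VG v n (σ z) := by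
  rcases eq_or_ne z 0 with rfl | hz
  · rw [map_zero]; exact h
  obtain ⟨m, hm⟩ := ve_ex C.hv hz
  exact (C.aut σ z m hm).g (hm.le h)

variable {σ : M ≃ₐ[K] M} (hσ : ∀ z, σ (σ z) = z)
include hσ

theorem wp_e : VE v 2 (π * σ π) := C.hπ.mul C.hv (C.aut σ _ _ C.hπ)

omit C in
theorem wp_fix : σ (π * σ π) = π * σ π := by rw [map_mul, hσ, mul_comm]

theorem expand (z : M) : ∃ a b c d : K,
    z = (algebraMap K M a + algebraMap K M b * (π * σ π)) +
      (algebraMap K M c + algebraMap K M d * (π * σ π)) * π ∧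
    σ z - z = (algebraMap K M c + algebraMap K M d * (π * σ π)) * (σ π - π) := by
  obtain ⟨a, b, c, d, h⟩ := C.span _ (wp_e C hσ) z
  refine ⟨a, b, c, d, h, ?_⟩
  have := congrArg σ h
  simp only [map_add, map_mul, AlgEquiv.commutes, hσ] at this
  rw [this]
  linear_combination -h

variable {b : ℤ} (hb : VE v (b+1) (σ π - π))
include hb

theorem fix_form {z : M} (hz : σ z = z) : ∃ a b : K,
    z = algebraMap K M a + algebraMap K M b * (π * σ π) := by
  obtain ⟨a, b, c, d, h, h'⟩ := expand C hσ z
  rw [hz, sub_self] at h'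
  have := (mul_eq_zero.mp h'.symm).resolve_right (hb.ne C.hv)
  rw [this] at h
  exact ⟨a, b, by rw [h]; ring⟩

theorem fix_even {z : M} (hz : σ z = z) {n : ℤ} (h : VE v n z) : n % 2 = 0 := by
  obtain ⟨a, b, rfl⟩ := fix_form C hσ hb hz
  exact l_even C.hv C.hK (wp_e C hσ) a b n h

theorem brk_g {z : M} {n : ℤ} (h : VG v n z) : VG v (n+b) (σ z - z) := by
  obtain ⟨a, b, c, d, h1, h2⟩ := expand C hσ z
  rw [h2]
  rw [h1] at h
  have := (pair_g C.hv (lm_dist C.hv C.hK C.hπ (wp_e C hσ) a b c d) h).2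
  exact ((this.of_mul C.hv C.hπ).mul_e C.hv hb).mono (by omega)

theorem brk_e {z : M} {n : ℤ} (h : VE v n z) (hn : n % 2 = 1) : VE v (n+b) (σ z - z) := by
  obtain ⟨a, b, c, d, h1, h2⟩ := expand C hσ z
  rw [h2]
  rw [h1] at h
  rcases pair_e C.hv (lm_dist C.hv C.hK C.hπ (wp_e C hσ) a b c d) h with h | h
  · have := l_even C.hv C.hK (wp_e C hσ) _ _ _ h
    omega
  · exact ((h.of_mul C.hv C.hπ).mul C.hv hb).cast (by omega)

theorem brk_bound : b ≤ 4*e ∧ (b % 2 = 1 ∨ b = 4*e) := by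
  have hv := C.hv
  have h1 : VE v (4*e+1) (-(2*π)) := (C.two.mul hv C.hπ).neg hv
  have hfix : σ (σ π + π) = σ π + π := by rw [map_add, hσ, add_comm]
  have hd : ∀ m, VE v m (σ π + π) → ¬ VE v m (-(2*π)) := by
    intro m hm hm'
    have := fix_even C hσ hb hfix hm
    have := hm'.eq h1
    omega
  have he : σ π - π = (σ π + π) + (-(2*π)) := by ring
  rw [he] at hb
  have h2 := (pair_g hv hd (hb.g le_rfl)).2
  have := h1.le h2
  refine ⟨by omega, ?_⟩
  rcases pair_e hv hd hb with h | h
  · have : σ (σ π + π) = σ π + π := hfix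
    obtain ⟨a', b', hz⟩ := fix_form C hσ (b := b) (by rw [he]; exact hb) hfix
    rw [hz] at h
    have := l_even C.hv C.hK (wp_e C hσ) a' b' _ h
    omega
  · have := h.eq h1
    omega

/-- trace estimate -/
theorem tr_g {z : M} {n : ℤ} (h : VG v n z) : VG v (n+b) (σ z + z) := by
  have e : σ z + z = (σ z - z) + 2 * z := by ring
  have hb' := (brk_bound C hσ hb).1
  rw [e]
  exact (brk_g C hσ hb h).add C.hv ((((C.two.g le_rfl).mul C.hv h)).mono (by omega))

theorem tr_e {z : M} {n : ℤ} (h : VE v n z) (hn : n % 2 = 1) (hlt : b < 4*e) :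
    VE v (n+b) (σ z + z) := by
  have e : σ z + z = (σ z - z) + 2 * z := by ring
  rw [e]
  exact (brk_e C hσ hb h hn).add_g C.hv (C.two.mul C.hv h |>.g le_rfl) (by omega)

variable {σ' : M ≃ₐ[K] M} (hσ' : ∀ z, σ' (σ' z) = z) (hc : ∀ z, σ (σ' z) = σ' (σ z)) {r : ℤ}
  (hr : VE v (2*r+2) (σ' (π * σ π) - π * σ π))
include hσ' hc hr

theorem brk2_g {z : M} (hz : σ z = z) {n : ℤ} (h : VG v n z) : VG v (n+2*r) (σ' z - z) := by
  obtain ⟨a, b, rfl⟩ := fix_form C hσ hb hz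
  have e : σ' (algebraMap K M a + algebraMap K M b * (π * σ π)) -
    (algebraMap K M a + algebraMap K M b * (π * σ π)) =
      algebraMap K M b * (σ' (π * σ π) - π * σ π) := by
    rw [map_add, map_mul]; simp only [AlgEquiv.commutes]; ring
  rw [e]
  have := (pair_g C.hv (kl_dist C.hv C.hK (wp_e C hσ) a b) h).2
  exact ((this.of_mul C.hv (wp_e C hσ)).mul_e C.hv hr).mono (by omega)

theorem brk2_e {z : M} (hz : σ z = z) {n : ℤ} (hn : n % 4 = 2) (h : VE v n z) :
    VE v (n+2*r) (σ' z - z) := by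
  obtain ⟨a, b, rfl⟩ := fix_form C hσ hb hz
  have e : σ' (algebraMap K M a + algebraMap K M b * (π * σ π)) -
    (algebraMap K M a + algebraMap K M b * (π * σ π)) =
      algebraMap K M b * (σ' (π * σ π) - π * σ π) := by
    rw [map_add, map_mul]; simp only [AlgEquiv.commutes]; ring
  rw [e]
  rcases pair_e C.hv (kl_dist C.hv C.hK (wp_e C hσ) a b) h with h | h
  · have := C.hK _ _ h
    omega
  · exact ((h.of_mul C.hv (wp_e C hσ)).mul C.hv hr).cast (by omega)

theorem brk2_bound : r ≤ 2*e ∧ (r % 2 = 1 ∨ r = 2*e) := by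
  have hv := C.hv
  have h1 : VE v (4*e+2) (-(2*(π * σ π))) := (C.two.mul hv (wp_e C hσ)).neg hv
  have hfix : σ (σ' (π * σ π) + π * σ π) = σ' (π * σ π) + π * σ π := by
    rw [map_add, hc, wp_fix hσ]
  obtain ⟨a, b', hz⟩ := fix_form C hσ hb hfix
  have hfix' : σ' (σ' (π * σ π) + π * σ π) = σ' (π * σ π) + π * σ π := by
    rw [map_add, hσ', add_comm]
  have hb0 : algebraMap K M b' = 0 := by
    have e : algebraMap K M b' * (σ' (π * σ π) - π * σ π) = 0 := by
      rw [hz, map_add, map_mul] at hfix'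
      simp only [AlgEquiv.commutes] at hfix'
      linear_combination hfix'
    exact (mul_eq_zero.mp e).resolve_right (hr.ne hv)
  rw [hb0, zero_mul, add_zero] at hz
  have hd : ∀ m, VE v m (σ' (π * σ π) + π * σ π) → ¬ VE v m (-(2*(π * σ π))) := by
    intro m hm hm'
    rw [hz] at hm
    have := C.hK _ _ hm
    have := hm'.eq h1
    omega
  have he : σ' (π * σ π) - π * σ π = (σ' (π * σ π) + π * σ π) + (-(2*(π * σ π))) := by ring
  rw [he] at hr
  have h2 := (pair_g hv hd (hr.g le_rfl)).2
  have := h1.le h2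
  refine ⟨by omega, ?_⟩
  rcases pair_e hv hd hr with h | h
  · rw [hz] at h
    have := C.hK _ _ h
    omega
  · have := h.eq h1
    omega

end Brk

section BrkComp
variable {K M : Type*} [Field K] [Field M] [Algebra K M] {v : M → WithTop ℤ} {π : M} {e : ℤ}
  (C : TCtx K v π e) {σ σ' : M ≃ₐ[K] M} (hσ : ∀ z, σ (σ z) = z)
  (hc : ∀ z, σ (σ' z) = σ' (σ z))
  {b b' : ℤ} (hb : VE v (b+1) (σ π - π)) (hb' : VE v (b'+1) (σ' π - π))
include C hσ hc hb hb'

omit hσ hb in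
theorem comp_form : ∃ m, VE v b' m ∧
    σ' (π * σ π) - π * σ π = ((σ m + m) + m * σ m) * (π * σ π) := by
  have hp := C.hπ.ne C.hv
  refine ⟨(σ' π - π) * π⁻¹, (hb'.mul C.hv (C.hπ.inv C.hv)).cast (by omega), ?_⟩
  have hp' : σ π ≠ 0 := (C.aut σ _ _ C.hπ).ne C.hv
  simp only [map_mul, map_sub, map_inv₀]
  rw [hc π]
  field_simp
  ring

theorem comp_small (hlt : b' < b) : VE v (2*b'+2) (σ' (π * σ π) - π * σ π) := by
  obtain ⟨m, hm, e⟩ := comp_form C hc hb'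
  rw [e, add_comm (σ m + m)]
  have h1 := hm.mul C.hv (C.aut σ _ _ hm)
  have h2 := tr_g C hσ hb (hm.g le_rfl)
  exact ((h1.add_g C.hv h2 (by omega)).mul C.hv (wp_e C hσ)).cast (by omega)

theorem comp_big_g (hlt : b < b') : VG v (b+b'+2) (σ' (π * σ π) - π * σ π) := by
  obtain ⟨m, hm, e⟩ := comp_form C hc hb'
  rw [e]
  have h1 := hm.mul C.hv (C.aut σ _ _ hm)
  have h2 := tr_g C hσ hb (hm.g le_rfl)
  exact ((h2.add C.hv (h1.g (by omega))).mul_e C.hv (wp_e C hσ)).mono (by omega)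

theorem comp_big_e (hlt : b < b') (h4 : b < 4*e) (hodd : b' % 2 = 1) :
    VE v (b+b'+2) (σ' (π * σ π) - π * σ π) := by
  obtain ⟨m, hm, e⟩ := comp_form C hc hb'
  rw [e]
  have h1 := hm.mul C.hv (C.aut σ _ _ hm)
  have h2 := tr_e C hσ hb hm hodd h4
  exact ((h2.add_g C.hv (h1.g le_rfl) (by omega)).mul C.hv (wp_e C hσ)).cast (by omega)

end BrkComp


/-- a pair of commuting involutions with their breaks -/
structure Lev (K : Type*) {M : Type*} [Field K] [Field M] [Algebra K M] (v : M → WithTop ℤ)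
    (π : M) (σ σ' : M ≃ₐ[K] M) (b r : ℤ) : Prop where
  inv : ∀ z, σ (σ z) = z
  inv' : ∀ z, σ' (σ' z) = z
  comm : ∀ z, σ (σ' z) = σ' (σ z)
  hb : VE v (b+1) (σ π - π)
  hr : VE v (2*r+2) (σ' (π * σ π) - π * σ π)

section Imp
variable {K M : Type*} [Field K] [Field M] [Algebra K M] {v : M → WithTop ℤ} {π : M} {e : ℤ}

theorem improve (P : M → Prop) (B : ℤ) (h1 : ∃ β, P β ∧ VG v 1 (β-1))
    (step : ∀ β i, P β → 1 ≤ i → i < B → VE v i (β-1) → ∃ β', P β' ∧ VG v (i+1) (β'-1)) :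
    ∃ β, P β ∧ VG v 1 (β-1) ∧ VG v B (β-1) := by
  have key : ∀ k : ℕ, ∃ β, P β ∧ VG v 1 (β-1) ∧ (VG v (1+k) (β-1) ∨ VG v B (β-1)) := by
    intro k
    induction k with
    | zero =>
      obtain ⟨β, h, h'⟩ := h1
      exact ⟨β, h, h', Or.inl (by simpa using h')⟩
    | succ k ih =>
      obtain ⟨β, h, h', h2 | h2⟩ := ih
      · rcases lt_or_ge (1+(k:ℤ)) B with h3 | h3
        · rcases h2.dich with h4 | h4
          · obtain ⟨β', hp, hg⟩ := step β _ h (by omega) h3 h4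
            exact ⟨β', hp, hg.mono (by omega), Or.inl (hg.mono (by push_cast; omega))⟩
          · exact ⟨β, h, h', Or.inl (h4.mono (by push_cast; omega))⟩
        · exact ⟨β, h, h', Or.inr (h2.mono h3)⟩
      · exact ⟨β, h, h', Or.inr h2⟩
  obtain ⟨β, h, h', h2 | h2⟩ := key (B.toNat)
  · exact ⟨β, h, h', h2.mono (by omega)⟩
  · exact ⟨β, h, h', h2⟩

variable (C : TCtx K v π e)
  (hres : ∀ z : M, VE v 0 z → ∃ c : K, VE v 0 (algebraMap K M c) ∧ VG v 1 (z - (algebraMap K M c)^2))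
  {p : K} (hp : VE v 4 (algebraMap K M p))
include C hres

theorem approx {n : ℤ} {z y : M} (hz : VE v n z) (hy : VE v n y) :
    ∃ c : K, VE v 0 (algebraMap K M c) ∧ VG v (n+1) (z - (algebraMap K M c)^2 * y) := by
  obtain ⟨c, hc, h⟩ := hres (z * y⁻¹) ((hz.mul C.hv (hy.inv C.hv)).cast (by omega))
  refine ⟨c, hc, ?_⟩
  have := h.mul_e C.hv hy
  have e : (z * y⁻¹ - (algebraMap K M c)^2) * y = z - (algebraMap K M c)^2 * y := by
    have := hy.ne C.hv
    field_simp
  rw [e] at this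
  exact this.mono (by omega)

include hp in
theorem kstep {β : M} {i : ℤ} (hi : i % 4 = 0) (h1 : 1 ≤ i) (h : VE v i (β-1)) :
    ∃ c : K, c ≠ 0 ∧ VG v (i+1) (algebraMap K M c * β - 1) := by
  have hq : VE v i ((algebraMap K M p)^(i/4)) := (hp.zpow C.hv (i/4)).cast (by omega)
  obtain ⟨c, hc, hg⟩ := approx C hres h hq
  have hqq : VE v i ((algebraMap K M c)^2 * (algebraMap K M p)^(i/4)) :=
    ((hc.sq C.hv).mul C.hv hq).cast (by omega)
  have key : VG v (i+1) (algebraMap K M (1 - c^2 * p^(i/4)) * β - 1) := by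
    have e : algebraMap K M (1 - c^2 * p^(i/4)) * β - 1
      = ((β-1) - (algebraMap K M c)^2 * (algebraMap K M p)^(i/4))
        - ((algebraMap K M c)^2 * (algebraMap K M p)^(i/4)) * (β-1) := by
      simp only [map_sub, map_mul, map_one, map_pow, map_zpow₀]; ring
    rw [e]
    exact hg.sub C.hv ((hqq.mul C.hv h).g (by omega))
  refine ⟨_, ?_, key⟩
  intro h0
  rw [h0] at key
  have := unit_of_sub_one C.hv (by omega) key
  exact this.ne C.hv (by simp)

include hp in
theorem kunit {β : M} {n : ℤ} (hn : n % 4 = 0) (h : VE v n β) :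
    ∃ c : K, c ≠ 0 ∧ VG v 1 (algebraMap K M c * β - 1) := by
  have hq : VE v n ((algebraMap K M p)^(n/4)) := (hp.zpow C.hv (n/4)).cast (by omega)
  obtain ⟨c, hc, hg⟩ := approx C hres h hq
  have hqq : VE v n ((algebraMap K M c)^2 * (algebraMap K M p)^(n/4)) :=
    ((hc.sq C.hv).mul C.hv hq).cast (by omega)
  have key : VG v 1 (algebraMap K M (c^2 * p^(n/4))⁻¹ * β - 1) := by
    have e : algebraMap K M (c^2 * p^(n/4))⁻¹ * β - 1
      = (β - (algebraMap K M c)^2 * (algebraMap K M p)^(n/4))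
        * ((algebraMap K M c)^2 * (algebraMap K M p)^(n/4))⁻¹ := by
      rw [sub_mul, mul_inv_cancel₀ (hqq.ne C.hv)]
      simp only [map_mul, map_pow, map_zpow₀, map_inv₀]; ring
    rw [e]
    exact (hg.mul_e C.hv (hqq.inv C.hv)).mono (by omega)
  refine ⟨_, ?_, key⟩
  intro h0
  rw [h0] at key
  have := unit_of_sub_one C.hv (by omega) key
  exact this.ne C.hv (by simp)

variable {σ σ' : M ≃ₐ[K] M} {b r : ℤ} (L : Lev K v π σ σ' b r)
include L

theorem sqstep {β : M} {i : ℤ} (hi : i % 4 = 0) (h1 : 1 ≤ i) (hi8 : i < 8*e) (h : VE v i (β-1)) :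
    ∃ y : M, y ≠ 0 ∧ σ y = y ∧ VG v (i+1) (β * y^2 - 1) := by
  have hw := wp_e C L.inv
  have hw4 : VE v (i/2) ((π * σ π)^(i/4)) := (hw.zpow C.hv (i/4)).cast (by omega)
  have hq : VE v i (((π * σ π)^(i/4))^2) := (hw4.sq C.hv).cast (by omega)
  obtain ⟨c, hc, hg⟩ := approx C hres h hq
  set ρ := algebraMap K M c * (π * σ π)^(i/4) with hρd
  have hρ : VE v (i/2) ρ := (hc.mul C.hv hw4).cast (by omega)
  have hu : VE v 0 (1+ρ) := (ve_one C.hv).add_g C.hv (hρ.g le_rfl) (by omega)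
  refine ⟨(1+ρ)⁻¹, inv_ne_zero (hu.ne C.hv), ?_, ?_⟩
  · rw [map_inv₀, map_add, map_one, hρd, map_mul, map_zpow₀, wp_fix L.inv, AlgEquiv.commutes]
  · have e : β * ((1+ρ)⁻¹)^2 - 1 = ((β - 1 - (algebraMap K M c)^2 * ((π * σ π)^(i/4))^2) - 2*ρ)
        * ((1+ρ)⁻¹)^2 := by
      have := hu.ne C.hv
      field_simp
      rw [hρd]; ring
    rw [e]
    refine (VG.mul_e C.hv (n := i+1) ?_ ((hu.inv C.hv).sq C.hv)).mono (by omega)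
    exact hg.sub C.hv ((C.two.mul C.hv hρ).g (by omega))

theorem sqlem {T n : ℤ} (hT : T ≤ 2*n+b) (k : ℕ) : ∀ δ : M, σ δ = δ → VG v (2*n) δ →
    VG v (T-k) δ → ∃ ρ, VG v n ρ ∧ VG v T (δ - ρ^2) := by
  have hbd := brk_bound C L.inv L.hb
  have hv := C.hv
  induction k with
  | zero => intro δ _ _ h; exact ⟨0, vg_zero C.hv _, by simpa using h⟩
  | succ k ih =>
    intro δ hδ h2n h
    rcases h.dich with h1 | h1
    · set t := T - ((k+1:ℕ):ℤ) with ht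
      have hev := fix_even C L.inv L.hb hδ h1
      have hle := h1.le h2n
      have hn' : VE v (t/2) (π^(t/2)) := (C.hπ.zpow hv (t/2)).cast (by omega)
      have hw : VE v t (-(π * σ π)^(t/2)) := (((wp_e C L.inv).zpow hv (t/2)).neg hv).cast (by omega)
      obtain ⟨c, hc, hg⟩ := approx C hres h1 hw
      set ρ := algebraMap K M c * π^(t/2) with hρd
      have hρ : VE v (t/2) ρ := (hc.mul hv hn').cast (by omega)
      have hN : δ - (algebraMap K M c)^2 * (-(π * σ π)^(t/2)) = δ + ρ * σ ρ := by
        rw [hρd, map_mul, map_zpow₀, AlgEquiv.commutes, mul_zpow]; ring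
      rw [hN] at hg
      obtain ⟨ρ₂, h3, h4⟩ := ih (δ + ρ * σ ρ)
        (by rw [map_add, map_mul, hδ, L.inv]; ring) (hg.mono (by omega))
        (hg.mono (by rw [ht]; push_cast; omega))
      refine ⟨ρ + ρ₂, (hρ.g (by omega)).add hv h3, ?_⟩
      have e : δ - (ρ + ρ₂)^2 = ((δ + ρ * σ ρ - ρ₂^2) - ρ * (σ ρ + ρ)) - 2 * ρ * ρ₂ := by ring
      rw [e]
      refine (h4.sub hv ?_).sub hv ?_
      · exact ((hρ.g le_rfl).mul hv (tr_g C L.inv L.hb (hρ.g le_rfl))).mono (by omega)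
      · exact (((C.two.mul hv hρ).g le_rfl).mul hv h3).mono (by omega)
    · exact ih δ hδ h2n (h1.mono (by push_cast; omega))

theorem approx_sq {n : ℤ} {δ : M} (hδ : σ δ = δ) (h : VG v (2*n) δ) :
    ∃ ρ, VG v n ρ ∧ VG v (2*n+b) (δ - ρ^2) :=
  sqlem C hres L le_rfl b.toNat δ hδ h (h.mono (by omega))

theorem exact_sq {n : ℤ} {δ : M} (hδ : σ δ = δ) (h : VE v (2*n) δ) (hn : n % 2 = 1)
    (hb4 : b < 4*e) : ∃ ρ, VE v n ρ ∧ VE v (2*n+b) (δ - ρ^2) := by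
  have hv := C.hv
  have hn' : VE v n (π^n) := (C.hπ.zpow hv n).cast (by omega)
  have hw : VE v (2*n) (-(π * σ π)^n) := (((wp_e C L.inv).zpow hv n).neg hv).cast (by omega)
  obtain ⟨c, hc, hg⟩ := approx C hres h hw
  set ρ := algebraMap K M c * π^n with hρd
  have hρ : VE v n ρ := (hc.mul hv hn').cast (by omega)
  have hN : δ - (algebraMap K M c)^2 * (-(π * σ π)^n) = δ + ρ * σ ρ := by
    rw [hρd, map_mul, map_zpow₀, AlgEquiv.commutes, mul_zpow]; ring
  rw [hN] at hg
  have hfix : σ (δ + ρ * σ ρ) = δ + ρ * σ ρ := by rw [map_add, map_mul, hδ, L.inv]; ring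
  have hg2 : VG v (2*(n+1)) (δ + ρ * σ ρ) := by
    rcases hg.dich with h1 | h1
    · have := fix_even C L.inv L.hb hfix h1
      omega
    · exact h1.mono (by omega)
  obtain ⟨ρ₂, h3, h4⟩ := approx_sq C hres L hfix hg2
  refine ⟨ρ + ρ₂, hρ.add_g hv h3 (by omega), ?_⟩
  have e : δ - (ρ + ρ₂)^2 = -(ρ * (σ ρ + ρ)) + ((δ + ρ * σ ρ - ρ₂^2) - 2 * ρ * ρ₂) := by ring
  rw [e]
  refine (((hρ.mul hv (tr_e C L.inv L.hb hρ hn hb4)).neg hv).cast (by omega)).add_g hv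
    (m := 2*n+b+1) ?_ (by omega)
  refine (h4.mono (by omega)).sub hv ?_
  exact (((C.two.mul hv hρ).g le_rfl).mul hv h3).mono (by omega)

theorem kill {n D : ℤ} {β : M} (hβ : σ β = β) (h1 : VG v 1 (β-1)) (hn : VG v n (β-1))
    (hD : D < n + b) (hD4 : D ≤ 4*e) : ∃ z, z ≠ 0 ∧ VG v (D+1) (β * z^2 - 1) := by
  have hv := C.hv
  have hfix : σ (β-1) = β-1 := by rw [map_sub, hβ, map_one]
  obtain ⟨n', hn1, hnn, hg⟩ : ∃ n', 1 ≤ n' ∧ n ≤ 2*n' ∧ VG v (2*n') (β-1) := by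
    rcases eq_or_ne (β-1) 0 with h0 | h0
    · exact ⟨max 1 n, by omega, by omega, by rw [h0]; exact vg_zero hv _⟩
    · obtain ⟨m, hm⟩ := ve_ex hv h0
      have := fix_even C L.inv L.hb hfix hm
      have := hm.le h1
      have := hm.le hn
      exact ⟨m/2, by omega, by omega, hm.g (by omega)⟩
  obtain ⟨ρ, h3, h4⟩ := approx_sq C hres L hfix hg
  have hu : VE v 0 (1+ρ) := (ve_one hv).add_g hv h3 (by omega)
  refine ⟨(1+ρ)⁻¹, inv_ne_zero (hu.ne hv), ?_⟩
  have e : β * ((1+ρ)⁻¹)^2 - 1 = ((β - 1 - ρ^2) - 2*ρ) * ((1+ρ)⁻¹)^2 := by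
    have := hu.ne hv
    field_simp
    ring
  rw [e]
  refine (VG.mul_e hv (n := D+1) ?_ ((hu.inv hv).sq hv)).mono (by omega)
  exact (h4.mono (by omega)).sub hv (((C.two.g le_rfl).mul hv h3).mono (by omega))

end Imp


section Fin
variable {K M : Type*} [Field K] [Field M] [Algebra K M] {v : M → WithTop ℤ} {π : M} {e : ℤ}
  (C : TCtx K v π e)
include C

section LevApi
variable {σ σ' : M ≃ₐ[K] M} {b r : ℤ} (L : Lev K v π σ σ' b r)
include L

theorem lev_even {z : M} (hz : σ z = z) {n : ℤ} (h : VE v n z) : n % 2 = 0 :=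
  fix_even C L.inv L.hb hz h

theorem lev_g {z : M} (hz : σ z = z) {n : ℤ} (h : VG v n z) : VG v (n+2*r) (σ' z - z) :=
  brk2_g C L.inv L.hb L.inv' L.comm L.hr hz h

theorem lev_e {z : M} (hz : σ z = z) {n : ℤ} (hn : n % 4 = 2) (h : VE v n z) :
    VE v (n+2*r) (σ' z - z) :=
  brk2_e C L.inv L.hb L.inv' L.comm L.hr hz hn h

theorem lev_bound : r ≤ 2*e ∧ (r % 2 = 1 ∨ r = 2*e) :=
  brk2_bound C L.inv L.hb L.inv' L.comm L.hr

theorem lev_b : b ≤ 4*e ∧ (b % 2 = 1 ∨ b = 4*e) := brk_bound C L.inv L.hb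

/-- norm of `1 + m`, inequality form -/
theorem nrm_g {β : M} (hβ : σ β = β) {i a : ℤ} (h : VG v i (β-1)) (h1 : a ≤ i + 2*r)
    (h3 : a ≤ 2*i) : VG v a (β * σ' β - 1) := by
  have hv := C.hv
  have hr := (lev_bound C L).1
  have hfix : σ (β-1) = β-1 := by rw [map_sub, hβ, map_one]
  have h5 := lev_g C L hfix h
  have e1 : β * σ' β - 1 = ((σ' (β-1) - (β-1)) + 2*(β-1)) + (β-1) * σ' (β-1) := by
    rw [map_sub, map_one]; ring
  rw [e1]
  refine ((h5.mono h1).add hv (((C.two.g le_rfl).mul hv h).mono (by omega))).add hv ?_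
  exact (h.mul hv (C.autg σ' h)).mono (by omega)

theorem nrm_e {β : M} (hβ : σ β = β) {i : ℤ} (h : VE v i (β-1)) (h1 : i < 2*r) :
    VE v (2*i) (β * σ' β - 1) := by
  have hv := C.hv
  have hr := (lev_bound C L).1
  have hfix : σ (β-1) = β-1 := by rw [map_sub, hβ, map_one]
  have h5 := lev_g C L hfix (h.g le_rfl)
  have e1 : β * σ' β - 1 = (β-1) * σ' (β-1) + ((σ' (β-1) - (β-1)) + 2*(β-1)) := by
    rw [map_sub, map_one]; ring
  rw [e1]
  refine ((h.mul hv (C.aut σ' _ _ h)).cast (by omega)).add_g hv (m := i+2*r) ?_ (by omega)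
  exact h5.add hv (((C.two.mul hv h).g le_rfl).mono (by omega))

end LevApi

variable (hres : ∀ z : M, VE v 0 z → ∃ c : K, VE v 0 (algebraMap K M c) ∧ VG v 1 (z - (algebraMap K M c)^2))
  {p : K} (hp : VE v 4 (algebraMap K M p))
  {σ σ' : M ≃ₐ[K] M} {b r : ℤ} (L : Lev K v π σ σ' b r)
include hres L

theorem part_a {D : ℤ} (hD : D < 2*r + b) (hD4 : D ≤ 4*e) {k : K}
    (hk : k ≠ 0) : ∃ z : M, z ≠ 0 ∧ VG v (D+1) (algebraMap K M k * z^2 - 1) := by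
  have hv := C.hv
  have hr := (lev_bound C L).1
  have imp := improve (v := v)
    (fun β => σ β = β ∧ ∃ z, z ≠ 0 ∧ σ z = z ∧ β = algebraMap K M k * z^2) (2*r) ?_ ?_
  · obtain ⟨β, ⟨hβ, z, hz, hzf, e1⟩, h1, h2⟩ := imp
    obtain ⟨y, hy, hg⟩ := kill C hres L hβ h1 h2 hD hD4
    refine ⟨z*y, mul_ne_zero hz hy, ?_⟩
    have : algebraMap K M k * (z*y)^2 = β * y^2 := by rw [e1]; ring
    rw [this]; exact hg
  · obtain ⟨m, hm⟩ := ve_ex hv ((map_ne_zero (algebraMap K M)).mpr hk)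
    have hm4 := C.hK _ _ hm
    have hw := ((wp_e C L.inv).zpow hv (-(m/4)))
    have h0 : VE v 0 (algebraMap K M k * ((π * σ π)^(-(m/4)))^2) :=
      (hm.mul hv (hw.sq hv)).cast (by omega)
    obtain ⟨c, hc, hg⟩ := hres _ h0
    have hfix : σ ((π * σ π)^(-(m/4)) * (algebraMap K M c)⁻¹)
        = (π * σ π)^(-(m/4)) * (algebraMap K M c)⁻¹ := by
      rw [map_mul, map_zpow₀, wp_fix L.inv, map_inv₀, AlgEquiv.commutes]
    refine ⟨_, ⟨?_, (π * σ π)^(-(m/4)) * (algebraMap K M c)⁻¹,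
      mul_ne_zero (hw.ne hv) (inv_ne_zero (hc.ne hv)), hfix, rfl⟩, ?_⟩
    · rw [map_mul, map_pow, hfix, AlgEquiv.commutes]
    · have e2 : algebraMap K M k * ((π * σ π)^(-(m/4)) * (algebraMap K M c)⁻¹)^2 - 1
        = (algebraMap K M k * ((π * σ π)^(-(m/4)))^2 - (algebraMap K M c)^2)
          * ((algebraMap K M c)⁻¹)^2 := by
        have := hc.ne hv
        rw [sub_mul, ← mul_pow, mul_inv_cancel₀ this]; ring
      rw [e2]
      exact (hg.mul_e hv ((hc.inv hv).sq hv)).mono (by omega)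
  · rintro β i ⟨hβ, z, hz, hzf, e1⟩ h1 hi h
    have hfix : σ (β-1) = β-1 := by rw [map_sub, hβ, map_one]
    have hev := lev_even C L hfix h
    rcases (by omega : i % 4 = 0 ∨ i % 4 = 2) with h4 | h4
    · obtain ⟨y, hy, hyf, hg⟩ := sqstep C hres L h4 h1 (by omega) h
      refine ⟨_, ⟨?_, z*y, mul_ne_zero hz hy, ?_, ?_⟩, hg⟩
      · rw [map_mul, map_pow, hyf, hβ]
      · rw [map_mul, hzf, hyf]
      · rw [e1]; ring
    · exfalso
      have h5 := lev_e C L hfix h4 h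
      obtain ⟨n, hn⟩ := ve_ex hv hz
      have h6 : VG v (2*r) ((σ' z - z) * z⁻¹) :=
        ((lev_g C L hzf (hn.g le_rfl)).mul_e hv (hn.inv hv)).mono (by omega)
      have hu := unit_of_sub_one hv (by omega) (h.g le_rfl)
      have e2 : σ' (β - 1) - (β - 1) =
          (((σ' z - z) * z⁻¹)^2 + 2*((σ' z - z) * z⁻¹)) * β := by
        rw [e1]; simp only [map_sub, map_mul, map_pow, map_one, AlgEquiv.commutes]
        field_simp
        ring
      rw [e2] at h5
      have h7 : VG v (4*r) ((((σ' z - z) * z⁻¹)^2 + 2*((σ' z - z) * z⁻¹)) * β) := by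
        refine (VG.mul_e hv (n := 4*r) ?_ hu).mono (by omega)
        exact ((h6.sq hv).mono (by omega)).add hv (((C.two.g le_rfl).mul hv h6).mono (by omega))
      have := h5.le h7
      omega

include hp

theorem part_b {D : ℤ} (hrodd : r % 2 = 1) (hD : D < 4*e - 2*r + b) (hD4 : D ≤ 4*e) {g : M}
    (hg0 : g ≠ 0) (hg : σ g = g) (hg' : σ' g = -g) :
    ∃ (k : K) (z : M), k ≠ 0 ∧ z ≠ 0 ∧ VG v (D+1) (algebraMap K M k * g * z^2 - 1) := by
  have hv := C.hv
  have imp := improve (v := v)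
    (fun β => σ β = β ∧ σ' β = -β ∧ ∃ k : K, k ≠ 0 ∧ β = algebraMap K M k * g) (4*e-2*r) ?_ ?_
  · obtain ⟨β, ⟨hβ, hβ', k, hk, e1⟩, h1, h2⟩ := imp
    obtain ⟨y, hy, hg⟩ := kill C hres L hβ h1 h2 hD hD4
    exact ⟨k, y, hk, hy, by rw [← e1]; exact hg⟩
  · obtain ⟨m, hm⟩ := ve_ex hv hg0
    have hev := lev_even C L hg hm
    have h4 : m % 4 = 0 := by
      by_contra h4
      have h5 := lev_e C L hg (by omega) hm
      have e2 : σ' g - g = -(2*g) := by rw [hg']; ring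
      rw [e2] at h5
      have := h5.eq ((C.two.mul hv hm).neg hv)
      omega
    obtain ⟨c, hc, hcg⟩ := kunit C hres hp h4 hm
    refine ⟨_, ⟨?_, ?_, c, hc, rfl⟩, hcg⟩
    · rw [map_mul, AlgEquiv.commutes, hg]
    · rw [map_mul, AlgEquiv.commutes, hg']; ring
  · rintro β i ⟨hβ, hβ', k, hk, e1⟩ h1 hi h
    have hfix : σ (β-1) = β-1 := by rw [map_sub, hβ, map_one]
    have hev := lev_even C L hfix h
    rcases (by omega : i % 4 = 0 ∨ i % 4 = 2) with h4 | h4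
    · obtain ⟨c, hc, hcg⟩ := kstep C hres hp h4 h1 h
      refine ⟨_, ⟨?_, ?_, c*k, mul_ne_zero hc hk, ?_⟩, hcg⟩
      · rw [map_mul, AlgEquiv.commutes, hβ]
      · rw [map_mul, AlgEquiv.commutes, hβ']; ring
      · rw [e1, map_mul]; ring
    · exfalso
      have h5 := lev_e C L hfix h4 h
      have hu := unit_of_sub_one hv (by omega) (h.g le_rfl)
      have e2 : σ' (β - 1) - (β - 1) = -(2*β) := by rw [map_sub, hβ', map_one]; ring
      rw [e2] at h5
      have := h5.eq ((C.two.mul hv hu).neg hv)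
      omega

theorem part_c {D B : ℤ} (hB1 : B ≤ 2*r) (hB2 : B ≤ 2*e) (hD : D < B + b) (hD4 : D ≤ 4*e) {τ : M}
    (hτ : σ τ = τ) (hτ' : τ * σ' τ = -1) :
    ∃ (k : K) (z : M), k ≠ 0 ∧ z ≠ 0 ∧ VG v (D+1) (algebraMap K M k * τ * z^2 - 1) := by
  have hv := C.hv
  have imp := improve (v := v)
    (fun β => σ β = β ∧ (∃ κ : K, β * σ' β = - (algebraMap K M κ)^2) ∧
      ∃ k : K, k ≠ 0 ∧ β = algebraMap K M k * τ) B ?_ ?_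
  · obtain ⟨β, ⟨hβ, hβ', k, hk, e1⟩, h1, h2⟩ := imp
    obtain ⟨y, hy, hg⟩ := kill C hres L hβ h1 h2 hD hD4
    exact ⟨k, y, hk, hy, by rw [← e1]; exact hg⟩
  · have hτ0 : τ ≠ 0 := by
      rintro rfl
      simp at hτ'
    obtain ⟨m, hm⟩ := ve_ex hv hτ0
    have h0 := hm.mul hv (C.aut σ' _ _ hm)
    rw [hτ'] at h0
    have := h0.eq (ve_neg_one hv)
    obtain ⟨c, hc, hcg⟩ := kunit C hres hp (by omega) hm
    refine ⟨_, ⟨?_, ⟨c, ?_⟩, c, hc, rfl⟩, hcg⟩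
    · rw [map_mul, AlgEquiv.commutes, hτ]
    · rw [map_mul, AlgEquiv.commutes]
      linear_combination (algebraMap K M c)^2 * hτ'
  · rintro β i ⟨hβ, ⟨κ, hβ'⟩, k, hk, e1⟩ h1 hi h
    have hfix : σ (β-1) = β-1 := by rw [map_sub, hβ, map_one]
    have hev := lev_even C L hfix h
    rcases (by omega : i % 4 = 0 ∨ i % 4 = 2) with h4 | h4
    · obtain ⟨c, hc, hcg⟩ := kstep C hres hp h4 h1 h
      refine ⟨_, ⟨?_, ⟨c*κ, ?_⟩, c*k, mul_ne_zero hc hk, ?_⟩, hcg⟩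
      · rw [map_mul, AlgEquiv.commutes, hβ]
      · rw [map_mul, AlgEquiv.commutes, map_mul]
        linear_combination (algebraMap K M c)^2 * hβ'
      · rw [e1, map_mul]; ring
    · exfalso
      have h5 := (nrm_e C L hβ h (by omega)).neg hv
      have h6 := h5.sub_g hv (C.two.g le_rfl) (by omega)
      have e2 : -(β * σ' β - 1) - 2 = (algebraMap K M κ - 1) * ((algebraMap K M κ - 1) + 2) := by
        rw [hβ']; ring
      rw [e2] at h6
      have h7 := sq_e hv C.two h6 (by omega)
      have e3 : algebraMap K M κ - 1 = algebraMap K M (κ - 1) := by rw [map_sub, map_one]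
      rw [e3] at h7
      have := C.hK _ _ h7
      omega

theorem part_d {ρ : M ≃ₐ[K] M} {b' : ℤ} (L2 : Lev K v π ρ σ' b' r) (hρ : ∀ z, ρ z = σ' (σ z))
    {D : ℤ} (hD : D = 4*e - 2*r + b) (hb4 : b < 4*e) (hbr : b < r) (her : e < r)
    {β₀ Y₀ ε : M} (hε : ε = 1 ∨ ε = -1) (hβ0 : β₀ ≠ 0) (hβ : σ β₀ = β₀)
    (hY : ρ Y₀ = Y₀) (hY' : σ' Y₀ = -Y₀) (hN : β₀ * σ' β₀ = ε * Y₀^2) :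
    ∃ (k : K) (z : M), k ≠ 0 ∧ z ≠ 0 ∧ VE v D (algebraMap K M k * β₀ * z^2 - 1) := by
  have hv := C.hv
  have hr := lev_bound C L
  have hcomm := L.comm
  -- passing from the norm to `Y`
  have y_e : ∀ {β Y : M} {a : ℤ}, β * σ' β = ε * Y^2 → a < 2*e → VE v (2*a) (β * σ' β - 1) →
      VE v a (Y-1) := by
    intro β Y a h1 ha h2
    refine sq_e hv C.two (?_ : VE v (2*a) _) (by omega)
    rcases hε with rfl | rfl
    · have e2 : β * σ' β - 1 = (Y-1)*((Y-1)+2) := by rw [h1]; ring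
      rw [← e2]; exact h2
    · have e2 : -(β * σ' β - 1) - 2 = (Y-1)*((Y-1)+2) := by rw [h1]; ring
      rw [← e2]; exact (h2.neg hv).sub_g hv (C.two.g le_rfl) (by omega)
  have y_g : ∀ {β Y : M} {a : ℤ}, β * σ' β = ε * Y^2 → a ≤ 2*e → a ≤ 4*e →
      VG v (2*a) (β * σ' β - 1) → VG v a (Y-1) := by
    intro β Y a h1 ha ha' h2
    refine sq_g hv C.two (?_ : VG v (2*a) _) ha'
    rcases hε with rfl | rfl
    · have e2 : β * σ' β - 1 = (Y-1)*((Y-1)+2) := by rw [h1]; ring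
      rw [← e2]; exact h2
    · have e2 : -(β * σ' β - 1) - 2 = (Y-1)*((Y-1)+2) := by rw [h1]; ring
      rw [← e2]; exact (h2.neg hv).sub hv (C.two.g (by omega))
  obtain ⟨m, hm⟩ := ve_ex hv hβ0
  have hev := lev_even C L hβ hm
  by_cases h4 : m % 4 = 2
  · have h5 := hm.mul hv (C.aut σ' _ _ hm)
    have h6 : VE v m Y₀ := by
      apply VE.of_sq hv
      rcases hε with rfl | rfl
      · have e2 : Y₀^2 = β₀ * σ' β₀ := by rw [hN]; ring
        rw [e2]; exact h5.cast (by omega)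
      · have e2 : Y₀^2 = -(β₀ * σ' β₀) := by rw [hN]; ring
        rw [e2]; exact (h5.neg hv).cast (by omega)
    have h7 := lev_e C L2 hY h4 h6
    have e3 : σ' Y₀ - Y₀ = -(2*Y₀) := by rw [hY']; ring
    rw [e3] at h7
    have h8 := h7.eq ((C.two.mul hv h6).neg hv)
    obtain ⟨q, hq, hq'⟩ := exact_sq C hres L (n := m/2) hβ (hm.cast (by omega)) (by omega) hb4
    refine ⟨1, q⁻¹, one_ne_zero, inv_ne_zero (hq.ne hv), ?_⟩
    have e4 : algebraMap K M 1 * β₀ * (q⁻¹)^2 - 1 = (β₀ - q^2) * (q⁻¹)^2 := by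
      have := hq.ne hv
      rw [map_one]; field_simp
    rw [e4]
    exact (hq'.mul hv ((hq.inv hv).sq hv)).cast (by omega)
  have imp := improve (v := v)
    (fun β => σ β = β ∧ (∃ Y, ρ Y = Y ∧ σ' Y = -Y ∧ β * σ' β = ε * Y^2) ∧
      ∃ (k : K) (z : M), k ≠ 0 ∧ z ≠ 0 ∧ β = algebraMap K M k * β₀ * z^2) (4*e-2*r) ?_ ?_
  · obtain ⟨β, ⟨hβf, ⟨Y, hYf, hYn, hYN⟩, k, z, hk, hz, e1⟩, h1, h2⟩ := imp
    have hfix : σ (β-1) = β-1 := by rw [map_sub, hβf, map_one]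
    have hVE : VE v (4*e-2*r) (β-1) := by
      rcases h2.dich with h3 | h3
      · exact h3
      exfalso
      have h5 : VG v (4*e-2*r+2) (β-1) := by
        rcases h3.dich with h5 | h5
        · have := lev_even C L hfix h5
          omega
        · exact h5.mono (by omega)
      have h6 : VG v (2*(4*e-2*r+2)) (β * σ' β - 1) := nrm_g C L hβf h5 (by omega) (by omega)
      have h7 := y_g hYN (by omega) (by omega) h6
      have hu := unit_of_sub_one hv (by omega) h7
      have h8 := lev_g C L2 (z := Y-1) (by rw [map_sub, hYf, map_one]) h7
      have e3 : σ' (Y-1) - (Y-1) = -(2*Y) := by rw [map_sub, hYn, map_one]; ring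
      rw [e3] at h8
      have := ((C.two.mul hv hu).neg hv).le h8
      omega
    have h3 := hVE.le h1
    obtain ⟨q, hq, hq'⟩ := exact_sq C hres L (n := 2*e-r) hfix (hVE.cast (by omega)) (by omega) hb4
    have hu : VE v 0 (1+q) := (ve_one hv).add_g hv (hq.g le_rfl) (by omega)
    refine ⟨k, z * (1+q)⁻¹, hk, mul_ne_zero hz (inv_ne_zero (hu.ne hv)), ?_⟩
    have e4 : algebraMap K M k * β₀ * (z * (1+q)⁻¹)^2 - 1 = ((β - 1 - q^2) - 2*q) * ((1+q)⁻¹)^2 := by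
      have := hu.ne hv
      have e5 : algebraMap K M k * β₀ * (z * (1+q)⁻¹)^2 = β * ((1+q)⁻¹)^2 := by rw [e1]; ring
      rw [e5]
      field_simp
      ring
    rw [e4]
    refine (VE.mul hv (hq'.sub_g hv ((C.two.mul hv hq).g le_rfl) (by omega))
      ((hu.inv hv).sq hv)).cast (by omega)
  · obtain ⟨c, hc, hcg⟩ := kunit C hres hp (by omega) hm
    refine ⟨_, ⟨?_, ⟨algebraMap K M c * Y₀, ?_, ?_, ?_⟩, c, 1, hc, one_ne_zero, ?_⟩, hcg⟩
    · rw [map_mul, AlgEquiv.commutes, hβ]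
    · rw [map_mul, AlgEquiv.commutes, hY]
    · rw [map_mul, AlgEquiv.commutes, hY']; ring
    · rw [map_mul, AlgEquiv.commutes]
      linear_combination (algebraMap K M c)^2 * hN
    · ring
  · rintro β i ⟨hβf, ⟨Y, hYf, hYn, hYN⟩, k, z, hk, hz, e1⟩ h1 hi h
    have hfix : σ (β-1) = β-1 := by rw [map_sub, hβf, map_one]
    have hev := lev_even C L hfix h
    rcases (by omega : i % 4 = 0 ∨ i % 4 = 2) with h5 | h5
    · obtain ⟨y, hy, hyf, hg⟩ := sqstep C hres L h5 h1 (by omega) h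
      refine ⟨_, ⟨?_, ⟨y * σ' y * Y, ?_, ?_, ?_⟩, k, z * y, hk, mul_ne_zero hz hy, ?_⟩, hg⟩
      · rw [map_mul, map_pow, hyf, hβf]
      · have e5 : ρ (σ' y) = y := by rw [hρ, hcomm, hyf, L.inv']
        have e6 : ρ y = σ' y := by rw [hρ, hyf]
        rw [map_mul, map_mul, hYf, e5, e6]; ring
      · rw [map_mul, map_mul, hYn, L.inv']; ring
      · rw [map_mul, map_pow]
        linear_combination (y * σ' y)^2 * hYN
      · rw [e1]; ring
    · exfalso
      have h6 := nrm_e C L hβf h (by omega)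
      have h7 := y_e hYN (by omega) h6
      have hu := unit_of_sub_one hv (by omega) (h7.g le_rfl)
      have h8 := lev_e C L2 (z := Y-1) (by rw [map_sub, hYf, map_one]) h5 h7
      have e3 : σ' (Y-1) - (Y-1) = -(2*Y) := by rw [map_sub, hYn, map_one]; ring
      rw [e3] at h8
      have := h8.eq ((C.two.mul hv hu).neg hv)
      omega

end Fin


section Core
variable {K M : Type*} [Field K] [Field M] [Algebra K M] {v : M → WithTop ℤ} {π : M} {e : ℤ}

/-- the ramification data of the biquadratic extension -/
structure Bq (K : Type*) {M : Type*} [Field K] [Field M] [Algebra K M] (v : M → WithTop ℤ)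
    (π : M) (e : ℤ) (σ₀ σ₁ σ₂ : M ≃ₐ[K] M) (b₁ b₂ s : ℤ) : Prop where
  L0 : Lev K v π σ₀ σ₁ b₂ b₁
  L1 : Lev K v π σ₁ σ₀ b₁ s
  L2 : Lev K v π σ₂ σ₀ b₁ s
  h12 : ∀ z, σ₂ z = σ₀ (σ₁ z)
  hs : 2*s = b₁ + b₂
  o1 : b₁ % 2 = 1
  o2 : b₂ % 2 = 1
  lt : b₁ < b₂
  p1 : 1 ≤ b₁
  u2 : b₂ < 4*e
  es : e < s

variable (C : TCtx K v π e)
include C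

theorem bq_of {σ₀ σ₁ σ₂ : M ≃ₐ[K] M} {b₁ b₂ : ℤ} (i0 : ∀ z, σ₀ (σ₀ z) = z)
    (i1 : ∀ z, σ₁ (σ₁ z) = z) (cm : ∀ z, σ₀ (σ₁ z) = σ₁ (σ₀ z)) (h12 : ∀ z, σ₂ z = σ₀ (σ₁ z))
    (hb0 : VE v (b₂+1) (σ₀ π - π)) (hb1 : VE v (b₁+1) (σ₁ π - π)) (hb2 : VE v (b₁+1) (σ₂ π - π))
    (hlt : b₁ < b₂) (hst : 2*e < b₁ + b₂) :
    ∃ s, Bq K v π e σ₀ σ₁ σ₂ b₁ b₂ s := by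
  have hv := C.hv
  have cm' : ∀ z, σ₁ (σ₀ z) = σ₀ (σ₁ z) := fun z => (cm z).symm
  have i2 : ∀ z, σ₂ (σ₂ z) = z := fun z => by rw [h12, h12, cm', i0, i1]
  have cm2 : ∀ z, σ₂ (σ₀ z) = σ₀ (σ₂ z) := fun z => by rw [h12, h12, cm']
  have q0 := brk_bound C i0 hb0
  have q1 := brk_bound C i1 hb1
  have hp1 : 0 ≤ b₁ := by
    have := hb1.le (((C.aut σ₁ _ _ C.hπ).g le_rfl).sub hv (C.hπ.g le_rfl))
    omega
  have L0 : Lev K v π σ₀ σ₁ b₂ b₁ := ⟨i0, i1, cm, hb0, comp_small C i0 cm hb0 hb1 hlt⟩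
  have ho1 : b₁ % 2 = 1 := by omega
  have ho2 : b₂ % 2 = 1 := by
    by_contra hne
    have hg := comp_big_g C i1 cm' hb1 hb0 hlt
    have hne0 : σ₀ (π * σ₁ π) - π * σ₁ π ≠ 0 := by
      intro h0
      have h3 := lev_e C L0 (sub_eq_zero.mp h0) (by norm_num) (wp_e C i1)
      rw [wp_fix i1, sub_self] at h3
      exact h3.ne hv rfl
    obtain ⟨m, hm⟩ := ve_ex hv hne0
    have hev := fix_even C i1 hb1 (z := σ₀ (π * σ₁ π) - π * σ₁ π)
      (by rw [map_sub, cm', wp_fix i1]) hm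
    have := hm.le hg
    have := brk2_bound C i1 hb1 (r := (m-2)/2) i0 cm' (hm.cast (by omega))
    omega
  refine ⟨(b₁+b₂)/2, L0, ⟨i1, i0, cm', hb1, ?_⟩, ⟨i2, i0, cm2, hb2, ?_⟩, h12, by omega, ho1, ho2,
    hlt, by omega, by omega, by omega⟩
  · exact (comp_big_e C i1 cm' hb1 hb0 hlt (by omega) ho2).cast (by omega)
  · exact (comp_big_e C i2 cm2 hb2 hb0 hlt (by omega) ho2).cast (by omega)

theorem core (hres : ∀ z : M, VE v 0 z → ∃ c : K, VE v 0 (algebraMap K M c) ∧ VG v 1 (z - (algebraMap K M c)^2))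
    {p : K} (hp : VE v 4 (algebraMap K M p))
    {σ₀ σ₁ σ₂ : M ≃ₐ[K] M} {b₁ b₂ s : ℤ} (Q : Bq K v π e σ₀ σ₁ σ₂ b₁ b₂ s)
    {g β Y ε τ α q : M} {k : K} (hk : k ≠ 0) (hq : q ≠ 0)
    (hα : α = algebraMap K M k * g * β * τ * q^2)
    (hg0 : g ≠ 0) (hg : σ₀ g = g) (hg' : σ₁ g = -g)
    (hε : ε = 1 ∨ ε = -1) (hβ0 : β ≠ 0) (hβ : σ₁ β = β)
    (hY : σ₂ Y = Y) (hY' : σ₀ Y = -Y) (hN : β * σ₀ β = ε * Y^2)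
    (hτ : τ = 1 ∨ (σ₀ τ = τ ∧ τ * σ₁ τ = -1) ∨ (σ₂ τ = τ ∧ τ * σ₀ τ = -1)) :
    ∃ z : M, z ≠ 0 ∧ VE v (4*e-b₂) (z^2 * α - 1) := by
  have hv := C.hv
  obtain ⟨L0, L1, L2, h12, hs, o1, o2, lt, p1, u2, es⟩ := Q
  obtain ⟨k1, z1, hk1, hz1, r1⟩ := part_b C hres hp L0 (D := 4*e-b₂) o1 (by omega) (by omega) hg0 hg hg'
  obtain ⟨k2, z2, hk2, hz2, r2⟩ := part_d C hres hp L1 L2 h12 (D := 4*e-b₂) (by omega) (by omega)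
    (by omega) es hε hβ0 hβ hY hY' hN
  obtain ⟨k3, z3, hk3, hz3, r3⟩ : ∃ (k : K) (z : M), k ≠ 0 ∧ z ≠ 0 ∧
      VG v (4*e-b₂+1) (algebraMap K M k * τ * z^2 - 1) := by
    rcases hτ with rfl | ⟨h1, h2⟩ | ⟨h1, h2⟩
    · exact ⟨1, 1, one_ne_zero, one_ne_zero, by simpa using vg_zero hv _⟩
    · exact part_c C hres hp L0 (B := min (2*b₁) (2*e)) (by omega) (by omega) (by omega) (by omega) h1 h2
    · exact part_c C hres hp L2 (B := 2*e) (by omega) (by omega) (by omega) (by omega) h1 h2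
  obtain ⟨z4, hz4, r4⟩ := part_a C hres L0 (D := 4*e-b₂) (by omega) (by omega)
    (k := k * (k1*k2*k3)⁻¹) (mul_ne_zero hk (inv_ne_zero (mul_ne_zero (mul_ne_zero hk1 hk2) hk3)))
  refine ⟨z1*z2*z3*z4*q⁻¹, by simp [hz1, hz2, hz3, hz4, hq], ?_⟩
  have r5 := one_mul_e hv (by omega) (one_mul_g hv (by omega) (one_mul_g hv (by omega) r1 r3) r4) r2
  have e1 : (z1*z2*z3*z4*q⁻¹)^2 * α = algebraMap K M k1 * g * z1^2 * (algebraMap K M k3 * τ * z3^2)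
      * (algebraMap K M (k * (k1*k2*k3)⁻¹) * z4^2) * (algebraMap K M k2 * β * z2^2) := by
    have a1 := (map_ne_zero (algebraMap K M)).mpr hk1
    have a2 := (map_ne_zero (algebraMap K M)).mpr hk2
    have a3 := (map_ne_zero (algebraMap K M)).mpr hk3
    rw [hα]
    simp only [map_mul, map_inv₀]
    field_simp
  rw [e1]; exact r5

end Core

section Gal
variable {K M : Type*} [Field K] [Field M] [Algebra K M]

theorem quad_elt {L : Type*} [Field L] [Algebra K L] {t : L} {d : K} (ht : t^2 = algebraMap K L d)
    (hadj : Algebra.adjoin K ({t} : Set L) = ⊤) (ζ : L) :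
    ∃ p q : K, ζ = algebraMap K L p + algebraMap K L q * t := by
  have hζ : ζ ∈ Algebra.adjoin K ({t} : Set L) := by rw [hadj]; trivial
  induction hζ using Algebra.adjoin_induction with
  | mem z hz => exact ⟨0, 1, by rw [Set.mem_singleton_iff] at hz; rw [hz]; simp⟩
  | algebraMap r => exact ⟨r, 0, by simp⟩
  | add z w _ _ h1 h2 =>
    obtain ⟨p, q, rfl⟩ := h1
    obtain ⟨p', q', rfl⟩ := h2
    exact ⟨p+p', q+q', by simp only [map_add]; ring⟩
  | mul z w _ _ h1 h2 =>
    obtain ⟨p, q, rfl⟩ := h1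
    obtain ⟨p', q', rfl⟩ := h2
    refine ⟨p*p'+q*q'*d, p*q'+q*p', ?_⟩
    simp only [map_add, map_mul]
    linear_combination (algebraMap K L q * algebraMap K L q') * ht

theorem biquad_elt {x y : M} {u v : K} (hx : x ^ 2 = algebraMap K M u) (hy : y ^ 2 = algebraMap K M v)
    (hadj : Algebra.adjoin K ({x, y} : Set M) = ⊤) (z : M) :
    ∃ a b c d : K, z = algebraMap K M a + algebraMap K M b * x + algebraMap K M c * y
      + algebraMap K M d * (x * y) := by
  have hz : z ∈ Algebra.adjoin K ({x, y} : Set M) := by rw [hadj]; trivial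
  induction hz using Algebra.adjoin_induction with
  | mem z hz =>
    rcases hz with rfl | hz
    · exact ⟨0, 1, 0, 0, by simp⟩
    · rw [Set.mem_singleton_iff] at hz
      exact ⟨0, 0, 1, 0, by simp [hz]⟩
  | algebraMap r => exact ⟨r, 0, 0, 0, by simp⟩
  | add z w _ _ h1 h2 =>
    obtain ⟨a, b, c, d, rfl⟩ := h1
    obtain ⟨a', b', c', d', rfl⟩ := h2
    exact ⟨a+a', b+b', c+c', d+d', by simp only [map_add]; ring⟩
  | mul z w _ _ h1 h2 =>
    obtain ⟨a, b, c, d, rfl⟩ := h1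
    obtain ⟨a', b', c', d', rfl⟩ := h2
    refine ⟨a*a'+b*b'*u+c*c'*v+d*d'*(u*v), a*b'+b*a'+c*d'*v+d*c'*v, a*c'+c*a'+b*d'*u+d*b'*u,
      a*d'+d*a'+b*c'+c*b', ?_⟩
    simp only [map_add, map_mul, ← hx, ← hy]
    ring

theorem biquad_fin {x y : M} {u v : K} (hx : x ^ 2 = algebraMap K M u) (hy : y ^ 2 = algebraMap K M v)
    (hadj : Algebra.adjoin K ({x, y} : Set M) = ⊤) :
    FiniteDimensional K M ∧ Module.finrank K M ≤ 4 := by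
  have hsurj : Function.Surjective (Fintype.linearCombination K (![1, x, y, x*y] : Fin 4 → M)) := by
    intro z
    obtain ⟨a, b, c, d, rfl⟩ := biquad_elt hx hy hadj z
    refine ⟨![a, b, c, d], ?_⟩
    simp [Fintype.linearCombination_apply, Fin.sum_univ_four, Algebra.smul_def]
  refine ⟨Module.Finite.of_surjective _ hsurj, ?_⟩
  have := LinearMap.finrank_le_finrank_of_surjective hsurj
  simpa using this

theorem aut_sq {x : M} {u : K} (hx : x ^ 2 = algebraMap K M u) (s : M ≃ₐ[K] M) : s x = x ∨ s x = -x := by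
  apply sq_eq_sq_iff_eq_or_eq_neg.mp
  rw [← map_pow, hx, AlgEquiv.commutes]

theorem aut_ext {x y : M} (hadj : Algebra.adjoin K ({x, y} : Set M) = ⊤) {s t : M ≃ₐ[K] M}
    (h1 : s x = t x) (h2 : s y = t y) : s = t := by
  have : (s : M →ₐ[K] M) = (t : M →ₐ[K] M) := by
    apply AlgHom.ext_of_adjoin_eq_top hadj
    rintro z (rfl | rfl)
    · exact h1
    · exact h2
  ext z
  exact DFunLike.congr_fun this z

theorem aut_pat {x y : M} {u v : K} (hx : x ^ 2 = algebraMap K M u) (hy : y ^ 2 = algebraMap K M v)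
    (hadj : Algebra.adjoin K ({x, y} : Set M) = ⊤) (hcard : Nat.card (M ≃ₐ[K] M) = 4) :
    (∃ s : M ≃ₐ[K] M, s x = x ∧ s y = -y ∧ s y ≠ y) ∧
    (∃ s : M ≃ₐ[K] M, s x = -x ∧ s y = y ∧ s x ≠ x) := by
  classical
  have hf : Finite (M ≃ₐ[K] M) := Nat.finite_of_card_ne_zero (by omega)
  have : Fintype (M ≃ₐ[K] M) := Fintype.ofFinite _
  let f : (M ≃ₐ[K] M) → Bool × Bool := fun s => (decide (s x = x), decide (s y = y))
  have key : ∀ {w : M} {d : K}, w^2 = algebraMap K M d → ∀ s t : M ≃ₐ[K] M,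
      (s w = w ↔ t w = w) → s w = t w := by
    intro w d hw s t h
    by_cases h1 : s w = w
    · rw [h1, h.mp h1]
    · have h2 : ¬ t w = w := fun h2 => h1 (h.mpr h2)
      rw [(aut_sq hw s).resolve_left h1, (aut_sq hw t).resolve_left h2]
  have hinj : Function.Injective f := by
    intro s t hst
    simp only [f, Prod.mk.injEq, decide_eq_decide] at hst
    exact aut_ext hadj (key hx s t hst.1) (key hy s t hst.2)
  have hbij : Function.Bijective f := by
    rw [Fintype.bijective_iff_injective_and_card]
    refine ⟨hinj, ?_⟩
    rw [← Nat.card_eq_fintype_card, hcard]; rfl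
  constructor
  · obtain ⟨s, hs⟩ := hbij.2 (true, false)
    simp only [f, Prod.mk.injEq, decide_eq_true_eq, decide_eq_false_iff_not] at hs
    exact ⟨s, hs.1, (aut_sq hy s).resolve_left hs.2, hs.2⟩
  · obtain ⟨s, hs⟩ := hbij.2 (false, true)
    simp only [f, Prod.mk.injEq, decide_eq_true_eq, decide_eq_false_iff_not] at hs
    exact ⟨s, (aut_sq hx s).resolve_left hs.1, hs.2, hs.1⟩

end Gal


section Ram

theorem ve_nsmul {F G : Type*} [Field F] [Field G] {v : F → WithTop ℤ} {w : G → WithTop ℤ}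
    {f : F → G} {d : ℕ} (h : ∀ a, w (f a) = d • v a) {n : ℤ} {a : F} (ha : VE v n a) :
    VE w (d*n) (f a) := by
  unfold VE at *
  rw [h, ha, ← nsmul_eq_mul]
  rfl

theorem vg_nsmul {F G : Type*} [Field F] [Field G] {v : F → WithTop ℤ} {w : G → WithTop ℤ}
    (hv : DiscreteVal F v) (hw : DiscreteVal G w)
    {f : F →+* G} {d : ℕ} (h : ∀ a, w (f a) = d • v a) {n : ℤ} {a : F} (ha : VG v n a) :
    VG w (d*n) (f a) := by
  rcases eq_or_ne a 0 with rfl | h0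
  · rw [map_zero]; exact vg_zero hw _
  obtain ⟨m, hm⟩ := ve_ex hv h0
  exact (ve_nsmul h hm).g (mul_le_mul_of_nonneg_left (hm.le ha) (by positivity))

theorem ve_nsmul_inv {F G : Type*} [Field F] [Field G] {v : F → WithTop ℤ} {w : G → WithTop ℤ}
    (hv : DiscreteVal F v) (hw : DiscreteVal G w)
    {f : F →+* G} {d : ℕ} (h : ∀ a, w (f a) = d • v a) {n : ℤ} {a : F} (ha : VE w n (f a)) :
    ∃ m, VE v m a ∧ n = d * m := by
  have h0 : a ≠ 0 := by
    rintro rfl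
    exact ha.ne hw (map_zero f)
  obtain ⟨m, hm⟩ := ve_ex hv h0
  exact ⟨m, hm, ha.eq (ve_nsmul h hm)⟩

theorem npart {M N : Type*} [Field M] [Field N] [Algebra M N] {vM : M → WithTop ℤ}
    {vN : N → WithTop ℤ} (hvM : DiscreteVal M vM) (hvN : DiscreteVal N vN)
    (hNram : ∀ a : M, vN (algebraMap M N a) = 2 • vM a) {e D : ℤ} (h2 : VE vM (4*e) (2:M))
    (hD : D % 2 = 1) (hD0 : 0 < D) (hD4 : D < 4*e) {α z : M} (hz : z ≠ 0)
    (h : VE vM D (z^2 * α - 1)) {w : N} (hw : w^2 = algebraMap M N α)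
    (hadj : Algebra.adjoin M ({w} : Set N) = ⊤) (s : N ≃ₐ[M] N) (hs : s w = -w)
    {π : N} (hπ : VE vN 1 π) : VE vN (8*e+1-D) (s π - π) := by
  have h2N : VE vN (8*e) (2:N) := by
    have := ve_nsmul hNram h2
    rw [map_ofNat] at this
    exact this.cast (by push_cast; ring)
  have hz' : algebraMap M N z ≠ 0 := (map_ne_zero _).mpr hz
  have h3 : VE vN D (w * algebraMap M N z - 1) := by
    refine sq_e hvN h2N ?_ (by omega)
    have h4 := ve_nsmul hNram h
    have e1 : (w * algebraMap M N z - 1) * ((w * algebraMap M N z - 1) + 2)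
        = algebraMap M N (z^2*α - 1) := by
      rw [map_sub, map_mul, map_pow, map_one, ← hw]; ring
    rw [e1]; exact h4.cast (by push_cast; ring)
  have hu := unit_of_sub_one hvN hD0 (h3.g le_rfl)
  obtain ⟨p, q, hpq⟩ := quad_elt hw hadj π
  have e2 : π = algebraMap M N (p + q * z⁻¹) + algebraMap M N (q * z⁻¹) * (w * algebraMap M N z - 1) := by
    rw [hpq]
    simp only [map_add, map_mul, map_inv₀]
    field_simp
    ring
  have hd : ∀ m, VE vN m (algebraMap M N (p + q * z⁻¹)) →
      ¬ VE vN m (algebraMap M N (q * z⁻¹) * (w * algebraMap M N z - 1)) := by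
    intro m h5 h6
    obtain ⟨m1, _, e3⟩ := ve_nsmul_inv hvM hvN hNram h5
    obtain ⟨m2, _, e4⟩ := ve_nsmul_inv hvM hvN hNram (h6.of_mul hvN h3)
    push_cast at e3 e4
    omega
  have hπ' := hπ
  rw [e2] at hπ'
  rcases pair_e hvN hd hπ' with h5 | h5
  · obtain ⟨m1, _, e3⟩ := ve_nsmul_inv hvM hvN hNram h5
    push_cast at e3
    omega
  · have h6 := h5.of_mul hvN h3
    have e5 : s π - π = -(2 * (algebraMap M N (q * z⁻¹) * (w * algebraMap M N z))) := by
      rw [hpq, map_add, map_mul, hs, AlgEquiv.commutes, AlgEquiv.commutes]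
      simp only [map_mul, map_inv₀]
      field_simp
      ring
    rw [e5]
    exact ((h2N.mul hvN (h6.mul hvN hu)).neg hvN).cast (by omega)

end Ram

/-- Stable two-break case (Lemma 4.1): `M = K(√u, √v)` fully ramified biquadratic with
breaks `b₁ < b₂` satisfying `b₁ + b₂ > 2 e_K`, embedded in a quaternion extension
`N = M(√α_k)` where `α_k = k·√(uv)·η·τ` or `k·√(uv)·η` (with
`N_{K(√u)/K}(η) = v`, `N_{K(√uv)/K}(τ) = -1`).  Then `def_M(α_k) = 4 e_K - b₂`, and
the third ramification break of `N/K` (the break of `N/M`) is `b₃ = 4 e_K + b₂`. -/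
theorem stable_two_break_defect
    (K : Type*) [Field K] [Algebra ℚ_[2] K] [FiniteDimensional ℚ_[2] K]
    (vK : K → WithTop ℤ) (hvK : DiscreteVal K vK)
    (eK : ℤ) (he : vK 2 = (eK : WithTop ℤ))
    (M : Type*) [Field M] [Algebra K M]
    (vM : M → WithTop ℤ) (hvM : DiscreteVal M vM)
    (hram : ∀ a : K, vM (algebraMap K M a) = 4 • vK a)
    (hbiquad : Nat.card (M ≃ₐ[K] M) = 4)
    (hexp2 : ∀ s : M ≃ₐ[K] M, s * s = 1)
    (u v : K) (x y : M) (hx : x ^ 2 = algebraMap K M u) (hy : y ^ 2 = algebraMap K M v)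
    (hadj : Algebra.adjoin K ({x, y} : Set M) = ⊤)
    (πM : M) (hπM : vM πM = 1)
    (b₁ b₂ : ℤ) (hb : b₁ < b₂) (hstable : 2 * eK < b₁ + b₂)
    (σ₀ : M ≃ₐ[K] M) (hσ₀ : σ₀ ≠ 1)
    (hbreak₂ : vM (σ₀ πM - πM) = ((b₂ + 1 : ℤ) : WithTop ℤ))
    (hbreak₁ : ∀ s : M ≃ₐ[K] M, s ≠ 1 → s ≠ σ₀ →
      vM (s πM - πM) = ((b₁ + 1 : ℤ) : WithTop ℤ))
    -- Lu = K(√u) and the element η of norm v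
    (Lu : Type*) [Field Lu] [Algebra K Lu] [Algebra Lu M] [IsScalarTower K Lu M]
    (xu : Lu) (hxu : algebraMap Lu M xu = x)
    (hLuadj : Algebra.adjoin K ({xu} : Set Lu) = ⊤)
    (su : Lu ≃ₐ[K] Lu) (hsu : su xu = -xu)
    (η : Lu) (hη : η * su η = algebraMap K Lu v)
    -- Luv = K(√(uv)) and the element τ of norm -1
    (Luv : Type*) [Field Luv] [Algebra K Luv] [Algebra Luv M] [IsScalarTower K Luv M]
    (zuv : Luv) (hzuv : algebraMap Luv M zuv = x * y)
    (hLuvadj : Algebra.adjoin K ({zuv} : Set Luv) = ⊤)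
    (suv : Luv ≃ₐ[K] Luv) (hsuv : suv zuv = -zuv)
    (τ : Luv) (hτ : τ * suv τ = algebraMap K Luv (-1))
    -- the element α = α_k
    (k : K) (hk : k ≠ 0) (α : M)
    (hα : α = algebraMap K M k * (x * y) * algebraMap Lu M η * algebraMap Luv M τ ∨
          α = algebraMap K M k * (x * y) * algebraMap Lu M η)
    -- the quaternion top level N = M(√α)
    (N : Type*) [Field N] [Algebra M N]
    (wN : N) (hwN : wN ^ 2 = algebraMap M N α)
    (hNadj : Algebra.adjoin M ({wN} : Set N) = ⊤)
    (vN : N → WithTop ℤ) (hvN : DiscreteVal N vN)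
    (hNram : ∀ a : M, vN (algebraMap M N a) = 2 • vM a)
    (sN : N ≃ₐ[M] N) (hsN : sN wN = -wN)
    (πN : N) (hπN : vN πN = 1) :
    HasQuadDefect vM α ((4 * eK - b₂ : ℤ) : WithTop ℤ) ∧
      vN (sN πN - πN) = ((4 * eK + b₂ + 1 : ℤ) : WithTop ℤ) := by
  have hv := hvM
  have two : VE vM (4*eK) (2:M) := by
    have := ve_nsmul hram (n := eK) (a := (2:K)) he
    rw [map_ofNat] at this
    exact this.cast (by push_cast; ring)
  have hπ : VE vM 1 πM := hπM
  have hK : ∀ (a : K) (m : ℤ), VE vM m (algebraMap K M a) → m % 4 = 0 := by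
    intro a m h
    obtain ⟨m1, _, e1⟩ := ve_nsmul_inv hvK hvM hram h
    push_cast at e1
    omega
  obtain ⟨hFD, hfin⟩ := biquad_fin hx hy hadj
  have C : TCtx K vM πM eK := ⟨hv, hK, hπ, fun ϖ hϖ z => span4 hv hK hπ hfin hϖ z,
    fun σ z n h => aut_e hv hK hπ hfin σ h, two⟩
  have inv : ∀ (s : M ≃ₐ[K] M) (z : M), s (s z) = z := fun s z => by
    have := DFunLike.congr_fun (hexp2 s) z
    simpa using this
  have comm : ∀ (s t : M ≃ₐ[K] M) (z : M), s (t z) = t (s z) := fun s t z => by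
    have h1 : s (t (s (t z))) = z := inv (s * t) z
    have h2 := congrArg t (congrArg s h1)
    rw [inv, inv] at h2
    exact h2
  -- ramification data for a second automorphism
  have mkQ : ∀ σ₁ : M ≃ₐ[K] M, σ₁ ≠ 1 → σ₁ ≠ σ₀ →
      ∃ s, Bq K vM πM eK σ₀ σ₁ (σ₀ * σ₁) b₁ b₂ s := by
    intro σ₁ h1 h2
    refine bq_of C (inv σ₀) (inv σ₁) (comm σ₀ σ₁) (fun z => rfl) hbreak₂ (hbreak₁ σ₁ h1 h2)
      (hbreak₁ _ ?_ ?_) hb hstable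
    · intro h
      apply h2
      ext z
      have h3 : σ₀ (σ₁ z) = z := DFunLike.congr_fun h z
      rw [← h3, inv, h3]
    · intro h
      exact h1 (mul_eq_left.mp h)
  -- the elements
  have hxu2 : xu^2 = algebraMap K Lu u := by
    apply (algebraMap Lu M).injective
    rw [map_pow, hxu, hx, ← IsScalarTower.algebraMap_apply]
  have hzuv2 : zuv^2 = algebraMap K Luv (u*v) := by
    apply (algebraMap Luv M).injective
    rw [map_pow, hzuv, mul_pow, hx, hy, ← IsScalarTower.algebraMap_apply, map_mul]
  obtain ⟨p, q, hpq⟩ := quad_elt hxu2 hLuadj η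
  obtain ⟨r, l, hrl⟩ := quad_elt hzuv2 hLuvadj τ
  have hηM : algebraMap Lu M η = algebraMap K M p + algebraMap K M q * x := by
    rw [hpq, map_add, map_mul, hxu, ← IsScalarTower.algebraMap_apply,
      ← IsScalarTower.algebraMap_apply]
  have hτM : algebraMap Luv M τ = algebraMap K M r + algebraMap K M l * (x*y) := by
    rw [hrl, map_add, map_mul, hzuv, ← IsScalarTower.algebraMap_apply,
      ← IsScalarTower.algebraMap_apply]
  have hηN : (algebraMap K M p + algebraMap K M q * x) * (algebraMap K M p - algebraMap K M q * x)
      = y^2 := by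
    have h1 := congrArg (algebraMap Lu M) hη
    rw [map_mul, hηM, hpq, map_add, map_mul, hsu, AlgEquiv.commutes, AlgEquiv.commutes, map_add,
      map_mul, map_neg, hxu, ← IsScalarTower.algebraMap_apply,
      ← IsScalarTower.algebraMap_apply, ← IsScalarTower.algebraMap_apply, ← hy] at h1
    linear_combination h1
  have hτN : (algebraMap K M r + algebraMap K M l * (x*y)) * (algebraMap K M r - algebraMap K M l * (x*y))
      = -1 := by
    have h1 := congrArg (algebraMap Luv M) hτ
    rw [map_mul, hτM, hrl, map_add, map_mul, hsuv, AlgEquiv.commutes, AlgEquiv.commutes, map_add,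
      map_mul, map_neg, hzuv, ← IsScalarTower.algebraMap_apply,
      ← IsScalarTower.algebraMap_apply, ← IsScalarTower.algebraMap_apply, map_neg, map_one] at h1
    linear_combination h1
  obtain ⟨⟨s1, s1x, s1y, s1n⟩, ⟨s2, s2x, s2y, s2n⟩⟩ := aut_pat hx hy hadj hbiquad
  have hx0 : x ≠ 0 := by
    rintro rfl
    simp at s2n
  have hy0 : y ≠ 0 := by
    rintro rfl
    simp at s1n
  have hη0 : algebraMap K M p + algebraMap K M q * x ≠ 0 := by
    intro h0
    rw [h0, zero_mul] at hηN
    exact pow_ne_zero 2 hy0 hηN.symm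
  have s1one : s1 ≠ 1 := by
    rintro rfl
    exact s1n rfl
  have s2one : s2 ≠ 1 := by
    rintro rfl
    exact s2n rfl
  have two0 : (2:M) ≠ 0 := two.ne hv
  have two0K : (2:K) ≠ 0 := VE.ne hvK (n := eK) he
  -- the tau factor
  obtain ⟨T, hT, hαT⟩ : ∃ T : M, (T = 1 ∨ T = algebraMap K M r + algebraMap K M l * (x*y)) ∧
      α = algebraMap K M k * (x*y) * (algebraMap K M p + algebraMap K M q * x) * T := by
    rcases hα with h | h
    · exact ⟨_, Or.inr rfl, by rw [h, hηM, hτM]⟩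
    · exact ⟨1, Or.inl rfl, by rw [h, hηM, mul_one]⟩
  have tfix : ∀ {ρ ρ' : M ≃ₐ[K] M}, ρ (x*y) = x*y → ρ' (x*y) = -(x*y) →
      (T = 1 ∨ (ρ T = T ∧ T * ρ' T = -1)) := by
    intro ρ ρ' h1 h2
    rcases hT with h | h
    · exact Or.inl h
    · right
      rw [h, map_add, map_add, map_mul _ _ (x*y), map_mul _ _ (x*y), h1, h2]
      simp only [AlgEquiv.commutes]
      exact ⟨trivial, by linear_combination hτN⟩
  -- main claim
  have main : 1 ≤ eK ∧ b₂ % 2 = 1 ∧ b₂ < 4*eK ∧ 1 ≤ b₂ ∧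
      ∃ z : M, z ≠ 0 ∧ VE vM (4*eK-b₂) (z^2 * α - 1) := by
    have fin : ∀ {σ₁ : M ≃ₐ[K] M} {s : ℤ} (Q : Bq K vM πM eK σ₀ σ₁ (σ₀*σ₁) b₁ b₂ s),
        ((∀ z : M, VE vM 0 z → ∃ c : K, VE vM 0 (algebraMap K M c) ∧
            VG vM 1 (z - (algebraMap K M c)^2)) → ∀ p : K, VE vM 4 (algebraMap K M p) →
          ∃ z : M, z ≠ 0 ∧ VE vM (4*eK-b₂) (z^2 * α - 1)) →
        1 ≤ eK ∧ b₂ % 2 = 1 ∧ b₂ < 4*eK ∧ 1 ≤ b₂ ∧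
          ∃ z : M, z ≠ 0 ∧ VE vM (4*eK-b₂) (z^2 * α - 1) := by
      intro σ₁ s Q h
      have := Q.p1
      have := Q.u2
      have := Q.o2
      have := Q.lt
      refine ⟨by omega, by omega, by omega, by omega, ?_⟩
      obtain ⟨pK, hpK⟩ := hvK.2.2.2.2
      refine h ?_ pK ((ve_nsmul hram (n := 1) hpK).cast (by norm_num))
      intro z hz
      obtain ⟨a, ha, hg⟩ := res_m hv hK hπ hfin hz
      obtain ⟨m1, hm1, e1⟩ := ve_nsmul_inv hvK hvM hram ha
      have hm0 : m1 = 0 := by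
        push_cast at e1
        omega
      subst hm0
      obtain ⟨c, hc, hcg⟩ := perf hvK (VE.g (n := eK) he (by omega)) hm1
      refine ⟨c, (ve_nsmul hram hc).cast (by norm_num), ?_⟩
      have h3 := vg_nsmul hvK hvM hram hcg
      rw [map_sub, map_pow] at h3
      have e2 : z - (algebraMap K M c)^2 = (z - algebraMap K M a)
          + (algebraMap K M a - (algebraMap K M c)^2) := by ring
      rw [e2]
      exact hg.add hv (h3.mono (by norm_num))
    rcases aut_sq hx σ₀ with h0x | h0x <;> rcases aut_sq hy σ₀ with h0y | h0y
    · exact absurd (aut_ext hadj (t := 1) h0x h0y) hσ₀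
    · -- the automorphism fixes `x`
      obtain ⟨s, Q⟩ := mkQ s2 s2one (by
        rintro rfl
        exact s2n h0x)
      refine fin Q ?_
      intro hres pK hpK
      have h2x : (σ₀ * s2) x = -x := by
        change σ₀ (s2 x) = -x
        rw [s2x, map_neg, h0x]
      have h2y : (σ₀ * s2) y = -y := by
        change σ₀ (s2 y) = -y
        rw [s2y, h0y]
      have hy2 : σ₀ y ≠ y := by
        intro h
        rw [h0y] at h
        have : 2 * y = 0 := by linear_combination -h
        rcases mul_eq_zero.mp this with h | h
        · exact two0 h
        · exact hy0 h
      have hpy : algebraMap K M p + y ≠ 0 := by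
        intro h
        have h3 : y = algebraMap K M (-p) := by rw [map_neg]; linear_combination h
        apply hy2
        rw [h3, AlgEquiv.commutes]
      have hsq : (algebraMap K M p + algebraMap K M q * x + y)^2
          = 2 * (algebraMap K M p + algebraMap K M q * x) * (algebraMap K M p + y) := by
        linear_combination -hηN
      have hqy : algebraMap K M p + algebraMap K M q * x + y ≠ 0 := by
        intro h
        rw [h] at hsq
        have := mul_ne_zero (mul_ne_zero two0 hη0) hpy
        apply this
        rw [← hsq]; ring
      refine core C hres hpK Q (g := x) (β := y * (algebraMap K M p + y))
        (Y := algebraMap K M q * (x*y)) (ε := -1) (τ := T)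
        (q := (algebraMap K M p + algebraMap K M q * x + y) * (algebraMap K M p + y)⁻¹)
        (k := k * 2⁻¹) (mul_ne_zero hk (inv_ne_zero two0K)) (mul_ne_zero hqy (inv_ne_zero hpy)) ?_
        hx0 h0x s2x (Or.inr rfl) (mul_ne_zero hy0 hpy) ?_ ?_ ?_ ?_ ?_
      · rw [hαT, mul_pow, hsq, map_mul, map_inv₀, map_ofNat]
        field_simp
      · rw [map_mul, map_add, s2y, AlgEquiv.commutes]
      · rw [map_mul, map_mul, h2x, h2y, AlgEquiv.commutes]; ring
      · rw [map_mul, map_mul, h0x, h0y, AlgEquiv.commutes]; ring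
      · rw [map_mul, map_add, h0y, AlgEquiv.commutes]
        linear_combination -y^2 * hηN
      · rcases tfix (ρ := σ₀ * s2) (ρ' := σ₀) (by rw [map_mul, h2x, h2y]; ring)
          (by rw [map_mul, h0x, h0y]; ring) with h | h
        · exact Or.inl h
        · exact Or.inr (Or.inr h)
    · -- the automorphism fixes `y`
      obtain ⟨s, Q⟩ := mkQ s1 s1one (by
        rintro rfl
        exact s1n h0y)
      refine fin Q ?_
      intro hres pK hpK
      have h2x : (σ₀ * s1) x = -x := by
        change σ₀ (s1 x) = -x
        rw [s1x, h0x]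
      have h2y : (σ₀ * s1) y = -y := by
        change σ₀ (s1 y) = -y
        rw [s1y, map_neg, h0y]
      refine core C hres hpK Q (g := y) (β := x * (algebraMap K M p + algebraMap K M q * x))
        (Y := x*y) (ε := -1) (τ := T) (q := 1) (k := k) hk one_ne_zero ?_
        hy0 h0y s1y (Or.inr rfl) (mul_ne_zero hx0 hη0) ?_ ?_ ?_ ?_ ?_
      · rw [hαT]; ring
      · simp only [map_mul, map_add, s1x, AlgEquiv.commutes]
      · rw [map_mul, h2x, h2y]; ring
      · rw [map_mul, h0x, h0y]; ring
      · simp only [map_mul, map_add, h0x, AlgEquiv.commutes]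
        linear_combination -x^2 * hηN
      · rcases tfix (ρ := σ₀ * s1) (ρ' := σ₀) (by rw [map_mul, h2x, h2y]; ring)
          (by rw [map_mul, h0x, h0y]; ring) with h | h
        · exact Or.inl h
        · exact Or.inr (Or.inr h)
    · -- the automorphism fixes the product
      obtain ⟨s, Q⟩ := mkQ s1 s1one (by
        rintro rfl
        rw [s1x] at h0x
        apply s2n
        rw [s2x, ← h0x])
      refine fin Q ?_
      intro hres pK hpK
      have h2x : (σ₀ * s1) x = -x := by
        change σ₀ (s1 x) = -x
        rw [s1x, h0x]
      have h2y : (σ₀ * s1) y = y := by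
        change σ₀ (s1 y) = y
        rw [s1y, map_neg, h0y, neg_neg]
      refine core C hres hpK Q (g := x*y) (β := algebraMap K M p + algebraMap K M q * x)
        (Y := y) (ε := 1) (τ := T) (q := 1) (k := k) hk one_ne_zero ?_
        (mul_ne_zero hx0 hy0) ?_ ?_ (Or.inl rfl) hη0 ?_ h2y h0y ?_ ?_
      · rw [hαT]; ring
      · rw [map_mul, h0x, h0y]; ring
      · rw [map_mul, s1x, s1y]; ring
      · simp only [map_mul, map_add, s1x, AlgEquiv.commutes]
      · simp only [map_mul, map_add, h0x, AlgEquiv.commutes]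
        linear_combination hηN
      · rcases tfix (ρ := σ₀) (ρ' := s1) (by rw [map_mul, h0x, h0y]; ring)
          (by rw [map_mul, s1x, s1y]; ring) with h | h
        · exact Or.inl h
        · exact Or.inr (Or.inl h)
  obtain ⟨e1, o2, u2, l2, z, hz, hVE⟩ := main
  refine ⟨defect_of_odd hv two (by omega) (by omega) (by omega) hVE, ?_⟩
  exact (npart hvM hvN hNram two (by omega) (by omega) (by omega) hz hVE hwN hNadj sN hsN
    (show VE vN 1 πN from hπN)).cast (by ring)
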